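/- There exist δ₀ > 0 and C > 0, depending only on p, μ, v_±, s and the profile ṽ, such that for every T > 0, every δ ≤ δ₀, and every classical solution (Φ,Ψ) of the integrated perturbation system on ℝ × [0,T] satisfying the a priori smallness assumption with parameter δ, for all t ∈ [0,T]: ‖(Φ_ξξξ, Ψ_ξξξ)(t)‖² + ∫₀ᵗ ∫_ℝ (Φ_ξξξξ² + Ψ_ξξξ²) dξ dτ ≤ C ‖(Φ₀,Ψ₀)‖₃². -/

import Mathlib

open MeasureTheory Filter Topology Set

noncomputable section

noncomputable def L2sq (w : ℝ → ℝ) : ℝ := ∫ ξ : ℝ, (w ξ) ^ 2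

noncomputable def HkSq (k : ℕ) (w : ℝ → ℝ) : ℝ :=
  ∑ j ∈ Finset.range (k + 1), L2sq (iteratedDeriv j w)

noncomputable def pairHkSq (k : ℕ) (F G : ℝ → ℝ) : ℝ := HkSq k F + HkSq k G

/-- The nonlinear remainder `G = (g'(v) - g'(ṽ))Φ_ξξ + (g'(v) - g'(ṽ) - g''(ṽ)Φ_ξ)ṽ_ξ`
with `v = ṽ + Φ_ξ`. -/
noncomputable def Gterm (g tv φ : ℝ → ℝ) (ξ : ℝ) : ℝ :=
  (deriv g (tv ξ + deriv φ ξ) - deriv g (tv ξ)) * iteratedDeriv 2 φ ξ +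
    (deriv g (tv ξ + deriv φ ξ) - deriv g (tv ξ)
      - deriv (deriv g) (tv ξ) * deriv φ ξ) * deriv tv ξ

/-- The relative pressure `p(v|ṽ) = p(v) - p(ṽ) - p'(ṽ)(v - ṽ)` with `v = ṽ + Φ_ξ`. -/
noncomputable def prel (p tv φ : ℝ → ℝ) (ξ : ℝ) : ℝ :=
  p (tv ξ + deriv φ ξ) - p (tv ξ) - deriv p (tv ξ) * deriv φ ξ

/-- A classical solution of the integrated perturbation system on `ℝ × [0,T]`:
`C⁴` in `ξ`, `C¹` in `t` with continuous mixed derivatives `∂_t ∂_ξ^j` (`j ≤ 3`),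
satisfying both equations pointwise, with square-integrable `ξ`-derivatives up to order 4
(`L²`-norms continuous in `t`) and derivatives up to order 3 decaying at spatial infinity,
uniformly in `t`. -/
structure IsClassicalSolution (p g tv : ℝ → ℝ) (s T : ℝ) (Φ Ψ : ℝ → ℝ → ℝ) : Prop where
  regΦ : ∀ t ∈ Set.Icc (0:ℝ) T, ContDiff ℝ 4 (Φ t)
  regΨ : ∀ t ∈ Set.Icc (0:ℝ) T, ContDiff ℝ 4 (Ψ t)
  tdiffΦ : ∀ j : ℕ, j ≤ 3 → ∀ t ∈ Set.Icc (0:ℝ) T, ∀ ξ : ℝ,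
    DifferentiableAt ℝ (fun τ => iteratedDeriv j (Φ τ) ξ) t
  tdiffΨ : ∀ j : ℕ, j ≤ 3 → ∀ t ∈ Set.Icc (0:ℝ) T, ∀ ξ : ℝ,
    DifferentiableAt ℝ (fun τ => iteratedDeriv j (Ψ τ) ξ) t
  mixContΦ : ∀ j : ℕ, j ≤ 3 → ContinuousOn
    (fun q : ℝ × ℝ => deriv (fun τ => iteratedDeriv j (Φ τ) q.2) q.1)
    (Set.Icc (0:ℝ) T ×ˢ (Set.univ : Set ℝ))
  mixContΨ : ∀ j : ℕ, j ≤ 3 → ContinuousOn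
    (fun q : ℝ × ℝ => deriv (fun τ => iteratedDeriv j (Ψ τ) q.2) q.1)
    (Set.Icc (0:ℝ) T ×ˢ (Set.univ : Set ℝ))
  spContΦ : ∀ j : ℕ, j ≤ 4 → ContinuousOn
    (fun q : ℝ × ℝ => iteratedDeriv j (Φ q.1) q.2)
    (Set.Icc (0:ℝ) T ×ˢ (Set.univ : Set ℝ))
  spContΨ : ∀ j : ℕ, j ≤ 4 → ContinuousOn
    (fun q : ℝ × ℝ => iteratedDeriv j (Ψ q.1) q.2)
    (Set.Icc (0:ℝ) T ×ˢ (Set.univ : Set ℝ))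
  eq1 : ∀ t ∈ Set.Icc (0:ℝ) T, ∀ ξ : ℝ,
    deriv (fun τ => Φ τ ξ) t - s * deriv (Φ t) ξ - deriv (Ψ t) ξ
        - deriv g (tv ξ) * iteratedDeriv 2 (Φ t) ξ
        - deriv (deriv g) (tv ξ) * deriv tv ξ * deriv (Φ t) ξ
      = Gterm g tv (Φ t) ξ
  eq2 : ∀ t ∈ Set.Icc (0:ℝ) T, ∀ ξ : ℝ,
    deriv (fun τ => Ψ τ ξ) t - s * deriv (Ψ t) ξ + deriv p (tv ξ) * deriv (Φ t) ξ
      = -prel p tv (Φ t) ξ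
  sqIntΦ : ∀ j : ℕ, j ≤ 4 → ∀ t ∈ Set.Icc (0:ℝ) T,
    MeasureTheory.Integrable (fun ξ : ℝ => (iteratedDeriv j (Φ t) ξ) ^ 2)
  sqIntΨ : ∀ j : ℕ, j ≤ 4 → ∀ t ∈ Set.Icc (0:ℝ) T,
    MeasureTheory.Integrable (fun ξ : ℝ => (iteratedDeriv j (Ψ t) ξ) ^ 2)
  l2ContΦ : ∀ j : ℕ, j ≤ 4 →
    ContinuousOn (fun t => L2sq (iteratedDeriv j (Φ t))) (Set.Icc (0:ℝ) T)
  l2ContΨ : ∀ j : ℕ, j ≤ 4 →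
    ContinuousOn (fun t => L2sq (iteratedDeriv j (Ψ t))) (Set.Icc (0:ℝ) T)
  decayΦ : ∀ j : ℕ, j ≤ 3 → ∀ ε > (0:ℝ), ∃ R : ℝ, ∀ t ∈ Set.Icc (0:ℝ) T, ∀ ξ : ℝ,
    R ≤ |ξ| → |iteratedDeriv j (Φ t) ξ| < ε
  decayΨ : ∀ j : ℕ, j ≤ 3 → ∀ ε > (0:ℝ), ∃ R : ℝ, ∀ t ∈ Set.Icc (0:ℝ) T, ∀ ξ : ℝ,
    R ≤ |ξ| → |iteratedDeriv j (Ψ t) ξ| < ε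

lemma exists_clamp_extension {W : ℝ → ℝ → ℝ} {T : ℝ} (hT : 0 < T)
    (hW : ContinuousOn (fun q : ℝ × ℝ => W q.1 q.2) (Icc (0:ℝ) T ×ˢ (univ : Set ℝ))) :
    ∃ V : ℝ → ℝ → ℝ, Continuous (Function.uncurry V) ∧
      ∀ τ ∈ Icc (0:ℝ) T, ∀ ξ, V τ ξ = W τ ξ := by
  refine ⟨fun τ ξ => W (max 0 (min τ T)) ξ, ?_, ?_⟩
  · refine hW.comp_continuous (f := fun q : ℝ × ℝ => (max 0 (min q.1 T), q.2)) (by fun_prop) ?_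
    rintro ⟨a, b⟩
    simp [hT.le]
  · rintro τ ⟨h1, h2⟩ ξ
    simp [h1, h2]

lemma intervalIntegral_swap_of_continuous {V : ℝ → ℝ → ℝ}
    (hV : Continuous (Function.uncurry V)) (a b c d : ℝ) :
    ∫ x in a..b, ∫ y in c..d, V x y = ∫ y in c..d, ∫ x in a..b, V x y := by
  apply intervalIntegral_intervalIntegral_swap
  have : IsCompact (uIcc a b ×ˢ uIcc c d) := isCompact_uIcc.prod isCompact_uIcc
  exact (hV.continuousOn.integrableOn_compact this).mono_set
    (prod_mono uIoc_subset_uIcc uIoc_subset_uIcc)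

/-- Two continuous functions with the same primitive on `[0,T]` agree on `[0,T]`. -/
lemma eq_of_primitive_eq {X Y : ℝ → ℝ} {T : ℝ} (hT : 0 < T) (hX : Continuous X)
    (hY : Continuous Y)
    (h : ∀ t ∈ Icc (0:ℝ) T, ∫ τ in (0:ℝ)..t, X τ = ∫ τ in (0:ℝ)..t, Y τ) :
    ∀ t ∈ Icc (0:ℝ) T, X t = Y t := by
  intro t ht
  have hx := (hX.integral_hasStrictDerivAt 0 t).hasDerivAt.hasDerivWithinAt (s := Icc (0:ℝ) T)
  have hy := (hY.integral_hasStrictDerivAt 0 t).hasDerivAt.hasDerivWithinAt (s := Icc (0:ℝ) T)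
  exact (uniqueDiffOn_Icc hT t ht).eq_deriv _ hx (hy.congr_of_mem (fun r hr => h r hr) ht)

/-- Interchange of a time derivative and a space derivative, with the mixed derivatives
continuous up to the boundary of the time interval. -/
lemma hasDerivAt_swap {u w Du Dw : ℝ → ℝ → ℝ} {T : ℝ} (hT : 0 < T)
    (hu : ∀ τ ∈ Icc (0:ℝ) T, ∀ ξ, HasDerivAt (fun r => u r ξ) (Du τ ξ) τ)
    (hw : ∀ τ ∈ Icc (0:ℝ) T, ∀ ξ, HasDerivAt (fun r => w r ξ) (Dw τ ξ) τ)
    (hux : ∀ τ ∈ Icc (0:ℝ) T, ∀ ξ, HasDerivAt (u τ) (w τ ξ) ξ)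
    (hwc : ∀ τ ∈ Icc (0:ℝ) T, Continuous (w τ))
    (hDu : ContinuousOn (fun q : ℝ × ℝ => Du q.1 q.2) (Icc (0:ℝ) T ×ˢ (univ : Set ℝ)))
    (hDw : ContinuousOn (fun q : ℝ × ℝ => Dw q.1 q.2) (Icc (0:ℝ) T ×ˢ (univ : Set ℝ))) :
    ∀ τ ∈ Icc (0:ℝ) T, ∀ ξ, HasDerivAt (Du τ) (Dw τ ξ) ξ := by
  obtain ⟨U, hUc, hU⟩ := exists_clamp_extension hT hDu
  obtain ⟨V, hVc, hV⟩ := exists_clamp_extension hT hDw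
  have h0 : (0:ℝ) ∈ Icc (0:ℝ) T := ⟨le_rfl, hT.le⟩
  have sub : ∀ t ∈ Icc (0:ℝ) T, uIcc 0 t ⊆ Icc (0:ℝ) T := by
    intro t ht
    rw [uIcc_of_le ht.1]
    exact Icc_subset_Icc_right ht.2
  have ftcU : ∀ t ∈ Icc (0:ℝ) T, ∀ ξ, ∫ τ in (0:ℝ)..t, U τ ξ = u t ξ - u 0 ξ := by
    intro t ht ξ
    apply intervalIntegral.integral_eq_sub_of_hasDerivAt (f := fun r => u r ξ)
    · intro x hx
      rw [hU x (sub t ht hx)]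
      exact hu x (sub t ht hx) ξ
    · exact Continuous.intervalIntegrable (by fun_prop) _ _
  have ftcV : ∀ t ∈ Icc (0:ℝ) T, ∀ ξ, ∫ τ in (0:ℝ)..t, V τ ξ = w t ξ - w 0 ξ := by
    intro t ht ξ
    apply intervalIntegral.integral_eq_sub_of_hasDerivAt (f := fun r => w r ξ)
    · intro x hx
      rw [hV x (sub t ht hx)]
      exact hw x (sub t ht hx) ξ
    · exact Continuous.intervalIntegrable (by fun_prop) _ _
  have key : ∀ ξ, ∀ τ ∈ Icc (0:ℝ) T, U τ ξ - U τ 0 = ∫ η in (0:ℝ)..ξ, V τ η := by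
    intro ξ
    apply eq_of_primitive_eq hT (by fun_prop)
    · exact intervalIntegral.continuous_parametric_intervalIntegral_of_continuous' hVc _ _
    intro t ht
    rw [intervalIntegral_swap_of_continuous hVc, intervalIntegral.integral_sub
      (Continuous.intervalIntegrable (by fun_prop) _ _)
      (Continuous.intervalIntegrable (by fun_prop) _ _), ftcU t ht, ftcU t ht]
    simp only [ftcV t ht]
    rw [intervalIntegral.integral_sub ((hwc t ht).intervalIntegrable _ _)
      ((hwc 0 h0).intervalIntegrable _ _),
      intervalIntegral.integral_eq_sub_of_hasDerivAt (fun x _ => hux t ht x)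
        ((hwc t ht).intervalIntegrable _ _),
      intervalIntegral.integral_eq_sub_of_hasDerivAt (fun x _ => hux 0 h0 x)
        ((hwc 0 h0).intervalIntegrable _ _)]
    ring
  intro τ hτ ξ
  have hVτ : Continuous (V τ) := by fun_prop
  have h1 := ((hVτ.integral_hasStrictDerivAt 0 ξ).hasDerivAt).const_add (U τ 0)
  rw [← hV τ hτ]
  refine h1.congr_of_eventuallyEq (Eventually.of_forall fun x => ?_)
  change Du τ x = U τ 0 + ∫ y in (0:ℝ)..x, V τ y
  rw [← hU τ hτ, ← key x τ hτ]
  ring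

lemma exists_cutoff : ∃ (χ χ' : ℕ → ℝ → ℝ) (K : ℝ),
    (∀ n ξ, HasDerivAt (χ n) (χ' n ξ) ξ) ∧ (∀ n, Continuous (χ' n)) ∧
    (∀ n ξ, |χ n ξ| ≤ 1) ∧ (∀ n ξ, |χ' n ξ| ≤ K / (n + 1)) ∧
    (∀ (n : ℕ) ξ, 2 * ((n:ℝ) + 1) ≤ |ξ| → χ n ξ = 0) ∧
    (∀ ξ, Tendsto (fun n => χ n ξ) atTop (𝓝 1)) := by
  let b : ContDiffBump (0:ℝ) := ⟨1, 2, one_pos, one_lt_two⟩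
  have hb : ContDiff ℝ 1 b := b.contDiff
  have hd : Continuous (deriv b) := hb.continuous_deriv le_rfl
  obtain ⟨K, hK⟩ := b.hasCompactSupport.deriv.exists_bound_of_continuous hd
  refine ⟨fun n ξ => b (ξ / (n + 1)), fun n ξ => deriv b (ξ / (n + 1)) * (1 / (n + 1)), K,
    ?_, ?_, ?_, ?_, ?_, ?_⟩
  · intro n ξ
    have h1 : HasDerivAt b (deriv b (ξ / (n + 1))) (ξ / (n + 1)) :=
      (hb.differentiable one_ne_zero _).hasDerivAt
    have h2 : HasDerivAt (fun x : ℝ => x / ((n:ℝ) + 1)) (1 / ((n:ℝ) + 1)) ξ :=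
      (hasDerivAt_id ξ).div_const _
    exact HasDerivAt.comp (h₂ := b) (h := fun x : ℝ => x / ((n:ℝ) + 1)) ξ h1 h2
  · intro n
    fun_prop
  · intro n ξ
    rw [abs_of_nonneg b.nonneg]
    exact b.le_one
  · intro n ξ
    have hn : (0:ℝ) < n + 1 := by positivity
    rw [abs_mul, abs_of_pos (by positivity : (0:ℝ) < 1 / (n + 1)), mul_one_div]
    gcongr
    exact hK _
  · intro n ξ hξ
    have hn : (0:ℝ) < n + 1 := by positivity
    apply b.zero_of_le_dist
    rw [Real.dist_eq, sub_zero, abs_div, abs_of_pos hn, le_div_iff₀ hn]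
    exact hξ
  · intro ξ
    apply tendsto_const_nhds.congr'
    obtain ⟨N, hN⟩ := exists_nat_gt |ξ|
    filter_upwards [eventually_ge_atTop N] with n hn
    symm
    apply b.one_of_mem_closedBall
    have hn' : (N:ℝ) ≤ n := by exact_mod_cast hn
    have hpos : (0:ℝ) < n + 1 := by positivity
    rw [Metric.mem_closedBall, Real.dist_eq, sub_zero, abs_div, abs_of_pos hpos,
      div_le_iff₀ hpos]
    change |ξ| ≤ 1 * _
    linarith

/-- Localized balance law: the density `f` has time derivative `A + ∂_ξ B`. -/
lemma localized_balance {f A B b : ℝ → ℝ → ℝ} {T : ℝ} (hT : 0 < T)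
    (hf : ∀ τ ∈ Icc (0:ℝ) T, ∀ ξ, HasDerivAt (fun r => f r ξ) (A τ ξ + b τ ξ) τ)
    (hc : ContinuousOn (fun q : ℝ × ℝ => A q.1 q.2 + b q.1 q.2)
      (Icc (0:ℝ) T ×ˢ (univ : Set ℝ)))
    (hB : ∀ τ ∈ Icc (0:ℝ) T, ∀ ξ, HasDerivAt (B τ) (b τ ξ) ξ)
    (hfi : ∀ τ ∈ Icc (0:ℝ) T, Integrable (f τ))
    (hAi : ∀ τ ∈ Icc (0:ℝ) T, Integrable (A τ))
    (hBi : ∀ τ ∈ Icc (0:ℝ) T, Integrable (B τ))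
    {χ χ' : ℝ → ℝ} {R K : ℝ} (hχ : ∀ ξ, HasDerivAt χ (χ' ξ) ξ)
    (hχ'c : Continuous χ')
    (hχ1 : ∀ ξ, |χ ξ| ≤ 1) (hχK : ∀ ξ, |χ' ξ| ≤ K) (hχ0 : ∀ ξ, R ≤ |ξ| → χ ξ = 0) :
    ∃ I : ℝ → ℝ, Continuous I ∧
      (∀ τ ∈ Icc (0:ℝ) T, I τ = (∫ ξ, χ ξ * A τ ξ) - ∫ ξ, χ' ξ * B τ ξ) ∧
      ∀ t ∈ Icc (0:ℝ) T,
        (∫ ξ, χ ξ * f t ξ) - (∫ ξ, χ ξ * f 0 ξ) = ∫ τ in (0:ℝ)..t, I τ := by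
  obtain ⟨V, hVc, hV⟩ := exists_clamp_extension (W := fun τ ξ => A τ ξ + b τ ξ) hT hc
  have hχc : Continuous χ := continuous_iff_continuousAt.2 fun x => (hχ x).continuousAt
  have h0 : (0:ℝ) ∈ Icc (0:ℝ) T := ⟨le_rfl, hT.le⟩
  have supp : ∀ h : ℝ → ℝ, Function.support (fun ξ => χ ξ * h ξ) ⊆ Ioc (-R) R := by
    intro h ξ hξ
    have : χ ξ ≠ 0 := fun hz => hξ (by simp [hz])
    have : |ξ| < R := by
      by_contra hcon
      exact this (hχ0 ξ (not_lt.1 hcon))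
    rw [abs_lt] at this
    exact ⟨this.1, this.2.le⟩
  have toInt : ∀ h : ℝ → ℝ, ∫ ξ, χ ξ * h ξ = ∫ ξ in (-R)..R, χ ξ * h ξ := fun h =>
    (intervalIntegral.integral_eq_integral_of_support_subset (supp h)).symm
  have mulχ : ∀ h : ℝ → ℝ, Integrable h → Integrable (fun ξ => χ ξ * h ξ) := fun h hh =>
    hh.bdd_mul (c := 1) hχc.aestronglyMeasurable (Eventually.of_forall hχ1)
  have mulχ' : ∀ h : ℝ → ℝ, Integrable h → Integrable (fun ξ => χ' ξ * h ξ) := fun h hh =>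
    hh.bdd_mul (c := K) hχ'c.aestronglyMeasurable (Eventually.of_forall hχK)
  have hkc : Continuous (Function.uncurry fun τ ξ => χ ξ * V τ ξ) := by
    have : Continuous fun q : ℝ × ℝ => V q.1 q.2 := hVc
    exact (hχc.comp continuous_snd).mul this
  refine ⟨fun τ => ∫ ξ in (-R)..R, χ ξ * V τ ξ,
    intervalIntegral.continuous_parametric_intervalIntegral_of_continuous' hkc _ _, ?_, ?_⟩
  · intro τ hτ
    have hVτ : Continuous (V τ) := by fun_prop
    have hVi : Integrable (fun ξ => χ ξ * V τ ξ) := by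
      apply (hχc.mul hVτ).integrable_of_hasCompactSupport
      exact HasCompactSupport.of_support_subset_isCompact isCompact_Icc
        ((supp (V τ)).trans Ioc_subset_Icc_self)
    have hbi : Integrable (fun ξ => χ ξ * b τ ξ) := by
      refine (hVi.sub (mulχ _ (hAi τ hτ))).congr (Eventually.of_forall fun ξ => ?_)
      simp only [Pi.sub_apply, hV τ hτ]
      ring
    have parts := integral_mul_deriv_eq_deriv_mul_of_integrable (u := χ) (v := B τ) (u' := χ')
      (v' := b τ) (fun x _ => hχ x) (fun x _ => hB τ hτ x) hbi (mulχ' _ (hBi τ hτ))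
      (mulχ _ (hBi τ hτ))
    change ∫ ξ in (-R)..R, χ ξ * V τ ξ = _
    rw [← toInt]
    simp only [hV τ hτ, mul_add]
    rw [integral_add (mulχ _ (hAi τ hτ)) hbi, parts]
    ring
  · intro t ht
    rw [intervalIntegral_swap_of_continuous hkc, ← integral_sub (mulχ _ (hfi t ht))
      (mulχ _ (hfi 0 h0))]
    simp only [← mul_sub]
    rw [toInt fun ξ => f t ξ - f 0 ξ]
    congr 1
    funext ξ
    rw [intervalIntegral.integral_const_mul]
    congr 1
    symm
    apply intervalIntegral.integral_eq_sub_of_hasDerivAt (f := fun r => f r ξ)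
    · intro x hx
      rw [uIcc_of_le ht.1] at hx
      have hx' : x ∈ Icc (0:ℝ) T := ⟨hx.1, hx.2.trans ht.2⟩
      rw [hV x hx']
      exact hf x hx' ξ
    · exact Continuous.intervalIntegrable (by fun_prop) _ _

/-- Energy inequality on the whole line from a pointwise balance law. -/
lemma energy_inequality {f A B b H : ℝ → ℝ → ℝ} {Q : ℝ → ℝ} {T M : ℝ} (hT : 0 < T)
    (hf : ∀ τ ∈ Icc (0:ℝ) T, ∀ ξ, HasDerivAt (fun r => f r ξ) (A τ ξ + b τ ξ) τ)
    (hc : ContinuousOn (fun q : ℝ × ℝ => A q.1 q.2 + b q.1 q.2)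
      (Icc (0:ℝ) T ×ˢ (univ : Set ℝ)))
    (hB : ∀ τ ∈ Icc (0:ℝ) T, ∀ ξ, HasDerivAt (B τ) (b τ ξ) ξ)
    (hfi : ∀ τ ∈ Icc (0:ℝ) T, Integrable (f τ))
    (hH : ∀ τ ∈ Icc (0:ℝ) T, Integrable (H τ))
    (hHM : ∀ τ ∈ Icc (0:ℝ) T, ∫ ξ, H τ ξ ≤ M)
    (hAH : ∀ τ ∈ Icc (0:ℝ) T, ∀ ξ, |A τ ξ| ≤ H τ ξ)
    (hBH : ∀ τ ∈ Icc (0:ℝ) T, ∀ ξ, |B τ ξ| ≤ H τ ξ)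
    (hQ : ContinuousOn Q (Icc (0:ℝ) T))
    (hAQ : ∀ τ ∈ Icc (0:ℝ) T, ∫ ξ, A τ ξ ≤ - Q τ) :
    ∀ t ∈ Icc (0:ℝ) T, (∫ ξ, f t ξ) + (∫ τ in (0:ℝ)..t, Q τ) ≤ ∫ ξ, f 0 ξ := by
  have h0 : (0:ℝ) ∈ Icc (0:ℝ) T := ⟨le_rfl, hT.le⟩
  have hBc : ∀ τ ∈ Icc (0:ℝ) T, Continuous (B τ) := fun τ hτ =>
    continuous_iff_continuousAt.2 fun x => (hB τ hτ x).continuousAt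
  have hAi : ∀ τ ∈ Icc (0:ℝ) T, Integrable (A τ) := by
    intro τ hτ
    refine (hH τ hτ).mono' ?_ (Eventually.of_forall (hAH τ hτ))
    have h1 : Continuous fun ξ => A τ ξ + b τ ξ :=
      hc.comp_continuous (f := fun ξ : ℝ => (τ, ξ)) (by fun_prop) (fun ξ => ⟨hτ, mem_univ _⟩)
    have h2 : Measurable (b τ) := by
      have : b τ = deriv (B τ) := funext fun ξ => (hB τ hτ ξ).deriv.symm
      rw [this]
      exact measurable_deriv _
    have h3 : Measurable (A τ) := by
      have : A τ = fun ξ => (A τ ξ + b τ ξ) - b τ ξ := by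
        funext ξ
        ring
      rw [this]
      exact h1.measurable.sub h2
    exact h3.aestronglyMeasurable
  have hBi : ∀ τ ∈ Icc (0:ℝ) T, Integrable (B τ) := fun τ hτ =>
    (hH τ hτ).mono' (hBc τ hτ).aestronglyMeasurable (Eventually.of_forall (hBH τ hτ))
  obtain ⟨χ, χ', K, hχ, hχ'c, hχ1, hχK, hχ0, hχt⟩ := exists_cutoff
  have hχc : ∀ n, Continuous (χ n) := fun n =>
    continuous_iff_continuousAt.2 fun x => (hχ n x).continuousAt
  have hK0 : 0 ≤ K := by simpa using (abs_nonneg _).trans (hχK 0 0)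
  have hχK' : ∀ n ξ, |χ' n ξ| ≤ K := fun n ξ => (hχK n ξ).trans
    (div_le_self hK0 (by linarith [(Nat.cast_nonneg n : (0:ℝ) ≤ n)]))
  have hχ't : ∀ ξ, Tendsto (fun n => χ' n ξ) atTop (𝓝 0) := by
    intro ξ
    refine squeeze_zero_norm (fun n => hχK n ξ) ?_
    have := (tendsto_one_div_add_atTop_nhds_zero_nat (𝕜 := ℝ)).const_mul K
    simpa [div_eq_mul_inv] using this
  have bal := fun n : ℕ => localized_balance hT hf hc hB hfi hAi hBi (hχ n)
    (hχ'c n) (hχ1 n) (hχK' n) (hχ0 n)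
  choose I hIc hI hIb using bal
  intro t ht
  have sub : uIcc 0 t ⊆ Icc (0:ℝ) T := by
    rw [uIcc_of_le ht.1]
    exact Icc_subset_Icc_right ht.2
  have limf : ∀ τ ∈ Icc (0:ℝ) T,
      Tendsto (fun n => ∫ ξ, χ n ξ * f τ ξ) atTop (𝓝 (∫ ξ, f τ ξ)) := by
    intro τ hτ
    refine tendsto_integral_of_dominated_convergence (fun ξ => |f τ ξ|)
      (fun n => (hχc n).aestronglyMeasurable.mul (hfi τ hτ).1) (hfi τ hτ).abs
      (fun n => Eventually.of_forall fun ξ => ?_) (Eventually.of_forall fun ξ => ?_)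
    · rw [norm_mul]
      exact mul_le_of_le_one_left (abs_nonneg _) (hχ1 n ξ)
    · simpa using (hχt ξ).mul_const (f τ ξ)
  have bound1 : ∀ τ ∈ Icc (0:ℝ) T, ∀ n, ‖∫ ξ, χ n ξ * A τ ξ‖ ≤ M := by
    intro τ hτ n
    refine le_trans (norm_integral_le_of_norm_le (hH τ hτ)
      (Eventually.of_forall fun ξ => ?_)) (hHM τ hτ)
    rw [norm_mul]
    exact (mul_le_of_le_one_left (abs_nonneg _) (hχ1 n ξ)).trans (hAH τ hτ ξ)
  have bound2 : ∀ τ ∈ Icc (0:ℝ) T, ∀ n, ‖∫ ξ, χ' n ξ * B τ ξ‖ ≤ K * M := by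
    intro τ hτ n
    refine le_trans (norm_integral_le_of_norm_le ((hH τ hτ).const_mul K)
      (Eventually.of_forall fun ξ => ?_)) ?_
    · rw [norm_mul]
      exact mul_le_mul (hχK' n ξ) (hBH τ hτ ξ) (abs_nonneg _) hK0
    · rw [integral_const_mul]
      exact mul_le_mul_of_nonneg_left (hHM τ hτ) hK0
  have limI : ∀ τ ∈ Icc (0:ℝ) T, Tendsto (fun n => I n τ) atTop (𝓝 (∫ ξ, A τ ξ)) := by
    intro τ hτ
    simp only [fun n => hI n τ hτ]
    have l1 : Tendsto (fun n => ∫ ξ, χ n ξ * A τ ξ) atTop (𝓝 (∫ ξ, A τ ξ)) := by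
      refine tendsto_integral_of_dominated_convergence (H τ)
        (fun n => (hχc n).aestronglyMeasurable.mul (hAi τ hτ).1) (hH τ hτ)
        (fun n => Eventually.of_forall fun ξ => ?_) (Eventually.of_forall fun ξ => ?_)
      · rw [norm_mul]
        exact (mul_le_of_le_one_left (abs_nonneg _) (hχ1 n ξ)).trans (hAH τ hτ ξ)
      · simpa using (hχt ξ).mul_const (A τ ξ)
    have l2 : Tendsto (fun n => ∫ ξ, χ' n ξ * B τ ξ) atTop (𝓝 (∫ _ : ℝ, (0:ℝ))) := by
      refine tendsto_integral_of_dominated_convergence (fun ξ => K * H τ ξ)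
        (fun n => (hχ'c n).aestronglyMeasurable.mul (hBi τ hτ).1) ((hH τ hτ).const_mul K)
        (fun n => Eventually.of_forall fun ξ => ?_) (Eventually.of_forall fun ξ => ?_)
      · rw [norm_mul]
        exact mul_le_mul (hχK' n ξ) (hBH τ hτ ξ) (abs_nonneg _) hK0
      · simpa using (hχ't ξ).mul_const (B τ ξ)
    simpa using l1.sub l2
  have boundI : ∀ n, ∀ τ ∈ Icc (0:ℝ) T, ‖I n τ‖ ≤ M + K * M := by
    intro n τ hτ
    rw [hI n τ hτ]
    exact (norm_sub_le _ _).trans (add_le_add (bound1 τ hτ n) (bound2 τ hτ n))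
  have subo : uIoc 0 t ⊆ Icc (0:ℝ) T := uIoc_subset_uIcc.trans sub
  have limInt : Tendsto (fun n => ∫ τ in (0:ℝ)..t, I n τ) atTop
      (𝓝 (∫ τ in (0:ℝ)..t, ∫ ξ, A τ ξ)) := by
    refine intervalIntegral.tendsto_integral_filter_of_dominated_convergence
      (fun _ => M + K * M) (Eventually.of_forall fun n => (hIc n).aestronglyMeasurable)
      (Eventually.of_forall fun n => Eventually.of_forall fun τ hτ => boundI n τ (subo hτ))
      intervalIntegrable_const (Eventually.of_forall fun τ hτ => limI τ (subo hτ))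
  have hAint : IntervalIntegrable (fun τ => ∫ ξ, A τ ξ) volume 0 t := by
    rw [intervalIntegrable_iff]
    have meas : AEStronglyMeasurable (fun τ => ∫ ξ, A τ ξ) (volume.restrict (uIoc 0 t)) :=
      aestronglyMeasurable_of_tendsto_ae atTop
        (fun n => (hIc n).aestronglyMeasurable)
        ((ae_restrict_iff' measurableSet_uIoc).2
          (Eventually.of_forall fun τ hτ => limI τ (subo hτ)))
    refine Integrable.mono' (g := fun _ => M) ?_ meas ?_
    · exact (intervalIntegrable_iff.1 intervalIntegrable_const)
    · refine (ae_restrict_iff' measurableSet_uIoc).2 (Eventually.of_forall fun τ hτ => ?_)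
      exact le_trans (norm_integral_le_of_norm_le (hH τ (subo hτ))
        (Eventually.of_forall (hAH τ (subo hτ)))) (hHM τ (subo hτ))
  have hQint : IntervalIntegrable Q volume 0 t := (hQ.mono sub).intervalIntegrable
  have eq : (∫ ξ, f t ξ) - (∫ ξ, f 0 ξ) = ∫ τ in (0:ℝ)..t, ∫ ξ, A τ ξ := by
    refine tendsto_nhds_unique ((limf t ht).sub (limf 0 h0)) ?_
    simpa only [fun n => hIb n t ht] using limInt
  have le : ∫ τ in (0:ℝ)..t, ∫ ξ, A τ ξ ≤ ∫ τ in (0:ℝ)..t, -Q τ :=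
    intervalIntegral.integral_mono_on ht.1 hAint hQint.neg
      fun τ hτ => hAQ τ ⟨hτ.1, hτ.2.trans ht.2⟩
  rw [intervalIntegral.integral_neg] at le
  linarith

lemma integrable_mul_of_sq {u w : ℝ → ℝ} (hu : Continuous u) (hw : Continuous w)
    (hu2 : Integrable fun x => u x ^ 2) (hw2 : Integrable fun x => w x ^ 2) :
    Integrable fun x => u x * w x := by
  refine (hu2.add hw2).mono' (hu.mul hw).aestronglyMeasurable
    (Eventually.of_forall fun x => ?_)
  rw [Real.norm_eq_abs, Pi.add_apply, abs_le]
  constructor <;> nlinarith [sq_nonneg (u x + w x), sq_nonneg (u x - w x)]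

lemma sq_le_integral_sq_add {u u' : ℝ → ℝ} (hu : ∀ x, HasDerivAt u (u' x) x)
    (hu' : Continuous u') (h0 : Integrable fun x => u x ^ 2)
    (h1 : Integrable fun x => u' x ^ 2) (x : ℝ) :
    u x ^ 2 ≤ (∫ y, u y ^ 2) + ∫ y, u' y ^ 2 := by
  have huc : Continuous u := continuous_iff_continuousAt.2 fun x => (hu x).continuousAt
  have hd : ∀ y, HasDerivAt (fun x => u x ^ 2) (2 * (u y * u' y)) y := by
    intro y
    refine ((hu y).pow 2).congr_deriv ?_
    norm_num
    ring
  have hi : Integrable fun y => 2 * (u y * u' y) :=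
    (integrable_mul_of_sq huc hu' h0 h1).const_mul 2
  have hlim := tendsto_zero_of_hasDerivAt_of_integrableOn_Iic (a := x) (fun y _ => hd y)
    hi.integrableOn h0.integrableOn
  have heq := integral_Iic_of_hasDerivAt_of_tendsto (a := x) (hd x).continuousAt.continuousWithinAt
    (fun y _ => hd y) hi.integrableOn hlim
  rw [sub_zero] at heq
  rw [← heq, ← integral_add h0 h1]
  calc ∫ y in Iic x, 2 * (u y * u' y)
      ≤ ∫ y in Iic x, (u y ^ 2 + u' y ^ 2) := by
        refine setIntegral_mono hi.integrableOn (h0.add h1).integrableOn fun y => ?_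
        simp only
        nlinarith [sq_nonneg (u y - u' y)]
    _ ≤ ∫ y, (u y ^ 2 + u' y ^ 2) :=
        setIntegral_le_integral (h0.add h1) (Eventually.of_forall fun y => by positivity)

lemma integral_sq_deriv_le {u u' u'' : ℝ → ℝ} (hu : ∀ x, HasDerivAt u (u' x) x)
    (hu' : ∀ x, HasDerivAt u' (u'' x) x) (hc : Continuous u'')
    (h0 : Integrable fun x => u x ^ 2) (h1 : Integrable fun x => u' x ^ 2)
    (h2 : Integrable fun x => u'' x ^ 2) {ε : ℝ} (hε : 0 < ε) :
    ∫ x, u' x ^ 2 ≤ ε * (∫ x, u'' x ^ 2) + 1 / (4 * ε) * ∫ x, u x ^ 2 := by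
  have huc : Continuous u := continuous_iff_continuousAt.2 fun x => (hu x).continuousAt
  have huc' : Continuous u' := continuous_iff_continuousAt.2 fun x => (hu' x).continuousAt
  have i01 := integrable_mul_of_sq huc huc' h0 h1
  have i02 := integrable_mul_of_sq huc hc h0 h2
  have i11 := integrable_mul_of_sq huc' huc' h1 h1
  have parts := integral_mul_deriv_eq_deriv_mul_of_integrable (u := u) (v := u') (u' := u')
    (v' := u'') (fun x _ => hu x) (fun x _ => hu' x) i02 i11 i01
  have e : ∫ x, u' x ^ 2 = ∫ x, -(u x * u'' x) := by
    rw [integral_neg, parts, neg_neg]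
    simp only [sq]
  rw [e, ← integral_const_mul, ← integral_const_mul,
    ← integral_add (h2.const_mul _) (h0.const_mul _)]
  refine integral_mono i02.neg ((h2.const_mul _).add (h0.const_mul _)) fun x => ?_
  have : ε * u'' x ^ 2 + 1 / (4 * ε) * u x ^ 2 - (-(u x * u'' x))
      = (2 * ε * u'' x + u x) ^ 2 / (4 * ε) := by
    field_simp
    ring
  have h : 0 ≤ (2 * ε * u'' x + u x) ^ 2 / (4 * ε) := by positivity
  simp only
  linarith

lemma hasDerivAt_iteratedDeriv {f : ℝ → ℝ} {n : ℕ} (hf : ContDiff ℝ n f) {j : ℕ} (hj : j < n)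
    (x : ℝ) : HasDerivAt (iteratedDeriv j f) (iteratedDeriv (j + 1) f x) x := by
  rw [iteratedDeriv_succ]
  exact (hf.differentiable_iteratedDeriv j (by exact_mod_cast hj) x).hasDerivAt

lemma contDiffOn_iteratedDeriv {F : ℝ → ℝ} (hF : ContDiffOn ℝ (⊤ : ℕ∞) F (Ioi 0)) (k : ℕ) :
    ContDiffOn ℝ (⊤ : ℕ∞) (iteratedDeriv k F) (Ioi 0) := by
  induction k with
  | zero => simpa using hF
  | succ k ih =>
    rw [iteratedDeriv_succ]
    exact ((contDiffOn_infty_iff_deriv_of_isOpen isOpen_Ioi).1 ih).2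

lemma hasDerivAt_iteratedDeriv_of_pos {F : ℝ → ℝ} (hF : ContDiffOn ℝ (⊤ : ℕ∞) F (Ioi 0))
    (k : ℕ) {z : ℝ} (hz : 0 < z) :
    HasDerivAt (iteratedDeriv k F) (iteratedDeriv (k + 1) F z) z := by
  rw [iteratedDeriv_succ]
  exact ((((contDiffOn_infty_iff_deriv_of_isOpen isOpen_Ioi).1
    (contDiffOn_iteratedDeriv hF k)).1 z hz).differentiableAt (Ioi_mem_nhds hz)).hasDerivAt

lemma exists_bound_iteratedDeriv {F : ℝ → ℝ} (hF : ContDiffOn ℝ (⊤ : ℕ∞) F (Ioi 0))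
    {l : ℝ} (hl : 0 < l) (u : ℝ) :
    ∃ C : ℝ, 0 ≤ C ∧ ∀ k ≤ 4, ∀ z ∈ Icc l u, |iteratedDeriv k F z| ≤ C := by
  have h : ∀ k, ∃ C, ∀ z ∈ Icc l u, |iteratedDeriv k F z| ≤ C := fun k =>
    isCompact_Icc.exists_bound_of_continuousOn
      ((contDiffOn_iteratedDeriv hF k).continuousOn.mono fun z hz => hl.trans_le hz.1)
  choose C hC using h
  refine ⟨∑ k ∈ Finset.range 5, |C k|, Finset.sum_nonneg fun _ _ => abs_nonneg _, ?_⟩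
  intro k hk z hz
  exact ((hC k z hz).trans (le_abs_self _)).trans
    (Finset.single_le_sum (f := fun k => |C k|) (fun _ _ => abs_nonneg _)
      (Finset.mem_range.2 (by omega)))

lemma abs_iteratedDeriv_sub_le {F : ℝ → ℝ} (hF : ContDiffOn ℝ (⊤ : ℕ∞) F (Ioi 0))
    {l u C : ℝ} (hl : 0 < l) (hC : ∀ k ≤ 4, ∀ z ∈ Icc l u, |iteratedDeriv k F z| ≤ C)
    {k : ℕ} (hk : k ≤ 3) {z w : ℝ} (hz : z ∈ Icc l u) (hw : w ∈ Icc l u) :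
    |iteratedDeriv k F w - iteratedDeriv k F z| ≤ C * |w - z| :=
  Convex.norm_image_sub_le_of_norm_hasDerivWithin_le (s := Icc l u)
    (fun x hx => (hasDerivAt_iteratedDeriv_of_pos hF k (hl.trans_le hx.1)).hasDerivWithinAt)
    (fun x hx => hC (k + 1) (by omega) x hx) (convex_Icc l u) hz hw

/-- Mean value theorem in an unordered form. -/
lemma exists_mean_value {F F' : ℝ → ℝ} {l u z w : ℝ}
    (hF : ∀ x ∈ Icc l u, HasDerivAt F (F' x) x) (hz : z ∈ Icc l u) (hw : w ∈ Icc l u) :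
    ∃ x ∈ Icc l u, |x - z| ≤ |w - z| ∧ F w - F z = F' x * (w - z) := by
  rcases lt_trichotomy z w with h | h | h
  · obtain ⟨x, hx, e⟩ := exists_hasDerivAt_eq_slope F F' h
      (fun x hx => (hF x ⟨hz.1.trans hx.1, hx.2.trans hw.2⟩).continuousAt.continuousWithinAt)
      (fun x hx => hF x ⟨hz.1.trans hx.1.le, hx.2.le.trans hw.2⟩)
    refine ⟨x, ⟨hz.1.trans hx.1.le, hx.2.le.trans hw.2⟩, ?_, ?_⟩
    · rw [abs_of_pos (by linarith [hx.1]), abs_of_pos (by linarith)]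
      linarith [hx.2]
    · rw [e, div_mul_cancel₀ _ (by linarith)]
  · subst h
    exact ⟨z, hz, by simp, by simp⟩
  · obtain ⟨x, hx, e⟩ := exists_hasDerivAt_eq_slope F F' h
      (fun x hx => (hF x ⟨hw.1.trans hx.1, hx.2.trans hz.2⟩).continuousAt.continuousWithinAt)
      (fun x hx => hF x ⟨hw.1.trans hx.1.le, hx.2.le.trans hz.2⟩)
    refine ⟨x, ⟨hw.1.trans hx.1.le, hx.2.le.trans hz.2⟩, ?_, ?_⟩
    · rw [abs_of_neg (by linarith [hx.2]), abs_of_neg (by linarith)]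
      linarith [hx.1]
    · rw [e]
      field_simp [show z - w ≠ 0 by linarith]
      ring

/-- First, second and third derivatives of `F ∘ w 0`, where `w (k+1)` is the derivative
of `w k`. -/
def chainDeriv₁ (F : ℝ → ℝ) (w : ℕ → ℝ) : ℝ := iteratedDeriv 1 F (w 0) * w 1

def chainDeriv₂ (F : ℝ → ℝ) (w : ℕ → ℝ) : ℝ :=
  iteratedDeriv 2 F (w 0) * w 1 ^ 2 + iteratedDeriv 1 F (w 0) * w 2

def chainDeriv₃ (F : ℝ → ℝ) (w : ℕ → ℝ) : ℝ :=
  iteratedDeriv 3 F (w 0) * w 1 ^ 3 + 3 * (iteratedDeriv 2 F (w 0) * (w 1 * w 2))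
    + iteratedDeriv 1 F (w 0) * w 3

lemma hasDerivAt_iteratedDeriv_comp {F : ℝ → ℝ} (hF : ContDiffOn ℝ (⊤ : ℕ∞) F (Ioi 0))
    {w : ℕ → ℝ → ℝ} {ξ : ℝ} (hpos : 0 < w 0 ξ)
    (hw : ∀ k < 3, HasDerivAt (w k) (w (k + 1) ξ) ξ) (k : ℕ) :
    HasDerivAt (fun x => iteratedDeriv k F (w 0 x))
      (iteratedDeriv (k + 1) F (w 0 ξ) * w 1 ξ) ξ :=
  (hasDerivAt_iteratedDeriv_of_pos hF k hpos).comp ξ (hw 0 (by norm_num))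

lemma hasDerivAt_comp_chainDeriv₁ {F : ℝ → ℝ} (hF : ContDiffOn ℝ (⊤ : ℕ∞) F (Ioi 0))
    {w : ℕ → ℝ → ℝ} {ξ : ℝ} (hpos : 0 < w 0 ξ)
    (hw : ∀ k < 3, HasDerivAt (w k) (w (k + 1) ξ) ξ) :
    HasDerivAt (fun x => F (w 0 x)) (chainDeriv₁ F fun k => w k ξ) ξ := by
  simpa [chainDeriv₁] using hasDerivAt_iteratedDeriv_comp hF hpos hw 0

lemma hasDerivAt_chainDeriv₁ {F : ℝ → ℝ} (hF : ContDiffOn ℝ (⊤ : ℕ∞) F (Ioi 0))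
    {w : ℕ → ℝ → ℝ} {ξ : ℝ} (hpos : 0 < w 0 ξ)
    (hw : ∀ k < 3, HasDerivAt (w k) (w (k + 1) ξ) ξ) :
    HasDerivAt (fun x => chainDeriv₁ F fun k => w k x) (chainDeriv₂ F fun k => w k ξ) ξ := by
  refine ((hasDerivAt_iteratedDeriv_comp hF hpos hw 1).mul (hw 1 (by norm_num))).congr_deriv ?_
  simp only [chainDeriv₂]
  ring

lemma hasDerivAt_chainDeriv₂ {F : ℝ → ℝ} (hF : ContDiffOn ℝ (⊤ : ℕ∞) F (Ioi 0))
    {w : ℕ → ℝ → ℝ} {ξ : ℝ} (hpos : 0 < w 0 ξ)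
    (hw : ∀ k < 3, HasDerivAt (w k) (w (k + 1) ξ) ξ) :
    HasDerivAt (fun x => chainDeriv₂ F fun k => w k x) (chainDeriv₃ F fun k => w k ξ) ξ := by
  refine (((hasDerivAt_iteratedDeriv_comp hF hpos hw 2).mul
    ((hw 1 (by norm_num)).pow 2)).add
    ((hasDerivAt_iteratedDeriv_comp hF hpos hw 1).mul (hw 2 (by norm_num)))).congr_deriv ?_
  simp only [chainDeriv₃, Pi.pow_apply]
  norm_num
  ring

lemma abs_chainDeriv₃_sub_le {F : ℝ → ℝ} (hF : ContDiffOn ℝ (⊤ : ℕ∞) F (Ioi 0))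
    {l u C M : ℝ} (hl : 0 < l) (hC0 : 0 ≤ C)
    (hC : ∀ k ≤ 4, ∀ z ∈ Icc l u, |iteratedDeriv k F z| ≤ C) {w φ : ℕ → ℝ}
    (hM : 1 ≤ M) (hw : ∀ k ≤ 3, |w k| ≤ M) (hφ : |φ 1| ≤ 1) (h0 : w 0 ∈ Icc l u)
    (h1 : w 0 + φ 0 ∈ Icc l u) :
    |chainDeriv₃ F (fun k => w k + φ k) - chainDeriv₃ F w
      - iteratedDeriv 1 F (w 0 + φ 0) * φ 3| ≤ 40 * C * M ^ 3 * (|φ 0| + |φ 1| + |φ 2|) := by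
  have L : ∀ k ≤ 3, |iteratedDeriv k F (w 0 + φ 0) - iteratedDeriv k F (w 0)| ≤ C * |φ 0| := by
    intro k hk
    simpa using abs_iteratedDeriv_sub_le hF hl hC hk h0 h1
  have l1 := L 1 (by norm_num)
  have l2 := L 2 (by norm_num)
  have l3 := L 3 le_rfl
  have b2 := hC 2 (by norm_num) _ h1
  have b3 := hC 3 (by norm_num) _ h0
  have w1 := hw 1 (by norm_num)
  have w2 := hw 2 (by norm_num)
  have w3 := hw 3 le_rfl
  have v1 : |w 1 + φ 1| ≤ 2 * M := (abs_add_le _ _).trans (by linarith)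
  simp only [chainDeriv₃]
  generalize iteratedDeriv 1 F (w 0 + φ 0) = a1 at *
  generalize iteratedDeriv 2 F (w 0 + φ 0) = a2 at *
  generalize iteratedDeriv 3 F (w 0 + φ 0) = a3 at *
  generalize iteratedDeriv 1 F (w 0) = b1 at *
  generalize iteratedDeriv 2 F (w 0) = c2 at *
  generalize iteratedDeriv 3 F (w 0) = c3 at *
  have M0 : 0 ≤ M := by linarith
  have M1 : M ≤ M ^ 3 := le_self_pow₀ hM (by norm_num)
  have M2 : M ^ 2 ≤ M ^ 3 := pow_le_pow_right₀ hM (by norm_num)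
  have e : a3 * (w 1 + φ 1) ^ 3 + 3 * (a2 * ((w 1 + φ 1) * (w 2 + φ 2))) + a1 * (w 3 + φ 3)
      - (c3 * w 1 ^ 3 + 3 * (c2 * (w 1 * w 2)) + b1 * w 3) - a1 * φ 3
      = (a3 - c3) * (w 1 + φ 1) ^ 3
        + c3 * (φ 1 * ((w 1 + φ 1) ^ 2 + (w 1 + φ 1) * w 1 + w 1 ^ 2))
        + 3 * (a2 * ((w 1 + φ 1) * φ 2)) + 3 * (a2 * (φ 1 * w 2))
        + 3 * ((a2 - c2) * (w 1 * w 2)) + (a1 - b1) * w 3 := by ring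
  rw [e]
  have t1 : |(a3 - c3) * (w 1 + φ 1) ^ 3| ≤ (C * |φ 0|) * (2 * M) ^ 3 := by
    rw [abs_mul, abs_pow]
    gcongr
  have t2 : |c3 * (φ 1 * ((w 1 + φ 1) ^ 2 + (w 1 + φ 1) * w 1 + w 1 ^ 2))|
      ≤ C * (|φ 1| * ((2 * M) ^ 2 + (2 * M) * M + M ^ 2)) := by
    rw [abs_mul, abs_mul]
    gcongr
    refine (abs_add_le _ _).trans (add_le_add ((abs_add_le _ _).trans (add_le_add ?_ ?_)) ?_)
    · rw [abs_pow]
      gcongr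
    · rw [abs_mul]
      gcongr
    · rw [abs_pow]
      gcongr
  have t3 : |3 * (a2 * ((w 1 + φ 1) * φ 2))| ≤ 3 * (C * ((2 * M) * |φ 2|)) := by
    rw [abs_mul, abs_mul, abs_mul, abs_of_pos (by norm_num : (0:ℝ) < 3)]
    gcongr
  have t4 : |3 * (a2 * (φ 1 * w 2))| ≤ 3 * (C * (|φ 1| * M)) := by
    rw [abs_mul, abs_mul, abs_mul, abs_of_pos (by norm_num : (0:ℝ) < 3)]
    gcongr
  have t5 : |3 * ((a2 - c2) * (w 1 * w 2))| ≤ 3 * ((C * |φ 0|) * (M * M)) := by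
    rw [abs_mul, abs_mul, abs_mul, abs_of_pos (by norm_num : (0:ℝ) < 3)]
    gcongr
  have t6 : |(a1 - b1) * w 3| ≤ (C * |φ 0|) * M := by
    rw [abs_mul]
    gcongr
  have q0 : 0 ≤ C * |φ 0| := by positivity
  have q1 : 0 ≤ C * |φ 1| := by positivity
  have q2 : 0 ≤ C * |φ 2| := by positivity
  refine (abs_add_le _ _).trans ((add_le_add ((abs_add_le _ _).trans (add_le_add
    ((abs_add_le _ _).trans (add_le_add ((abs_add_le _ _).trans (add_le_add
    ((abs_add_le _ _).trans (add_le_add t1 t2)) t3)) t4)) t5)) t6).trans ?_)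
  have M3 : 0 ≤ M ^ 3 := by positivity
  nlinarith [mul_le_mul_of_nonneg_left M1 q0, mul_le_mul_of_nonneg_left M2 q0,
    mul_le_mul_of_nonneg_left M1 q1, mul_le_mul_of_nonneg_left M2 q1,
    mul_le_mul_of_nonneg_left M1 q2, mul_le_mul_of_nonneg_left M2 q2,
    mul_nonneg q0 M3, mul_nonneg q1 M3, mul_nonneg q2 M3]

lemma abs_chainDeriv₂_sub_le {F : ℝ → ℝ} (hF : ContDiffOn ℝ (⊤ : ℕ∞) F (Ioi 0))
    {l u C M : ℝ} (hl : 0 < l) (hC0 : 0 ≤ C)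
    (hC : ∀ k ≤ 4, ∀ z ∈ Icc l u, |iteratedDeriv k F z| ≤ C) {w φ : ℕ → ℝ}
    (hM : 1 ≤ M) (hw : ∀ k ≤ 3, |w k| ≤ M) (hφ : |φ 1| ≤ 1) (h0 : w 0 ∈ Icc l u)
    (h1 : w 0 + φ 0 ∈ Icc l u) :
    |chainDeriv₂ F (fun k => w k + φ k) - chainDeriv₂ F w|
      ≤ 40 * C * M ^ 3 * (|φ 0| + |φ 1| + |φ 2|) := by
  have L : ∀ k ≤ 3, |iteratedDeriv k F (w 0 + φ 0) - iteratedDeriv k F (w 0)| ≤ C * |φ 0| := by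
    intro k hk
    simpa using abs_iteratedDeriv_sub_le hF hl hC hk h0 h1
  have l1 := L 1 (by norm_num)
  have l2 := L 2 (by norm_num)
  have b1 := hC 1 (by norm_num) _ h1
  have b2 := hC 2 (by norm_num) _ h0
  have w1 := hw 1 (by norm_num)
  have w2 := hw 2 (by norm_num)
  have v1 : |w 1 + φ 1| ≤ 2 * M := (abs_add_le _ _).trans (by linarith)
  simp only [chainDeriv₂]
  generalize iteratedDeriv 1 F (w 0 + φ 0) = a1 at *
  generalize iteratedDeriv 2 F (w 0 + φ 0) = a2 at *
  generalize iteratedDeriv 1 F (w 0) = c1 at *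
  generalize iteratedDeriv 2 F (w 0) = c2 at *
  have M0 : 0 ≤ M := by linarith
  have M1 : M ≤ M ^ 3 := le_self_pow₀ hM (by norm_num)
  have M2 : M ^ 2 ≤ M ^ 3 := pow_le_pow_right₀ hM (by norm_num)
  have M3 : 1 ≤ M ^ 3 := one_le_pow₀ hM
  have e : a2 * (w 1 + φ 1) ^ 2 + a1 * (w 2 + φ 2) - (c2 * w 1 ^ 2 + c1 * w 2)
      = (a2 - c2) * (w 1 + φ 1) ^ 2 + c2 * (φ 1 * ((w 1 + φ 1) + w 1))
        + a1 * φ 2 + (a1 - c1) * w 2 := by ring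
  rw [e]
  have t1 : |(a2 - c2) * (w 1 + φ 1) ^ 2| ≤ (C * |φ 0|) * (2 * M) ^ 2 := by
    rw [abs_mul, abs_pow]
    gcongr
  have t2 : |c2 * (φ 1 * ((w 1 + φ 1) + w 1))| ≤ C * (|φ 1| * (2 * M + M)) := by
    rw [abs_mul, abs_mul]
    gcongr
    exact (abs_add_le _ _).trans (add_le_add v1 w1)
  have t3 : |a1 * φ 2| ≤ C * |φ 2| := by
    rw [abs_mul]
    gcongr
  have t4 : |(a1 - c1) * w 2| ≤ (C * |φ 0|) * M := by
    rw [abs_mul]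
    gcongr
  have q0 : 0 ≤ C * |φ 0| := by positivity
  have q1 : 0 ≤ C * |φ 1| := by positivity
  have q2 : 0 ≤ C * |φ 2| := by positivity
  refine (abs_add_le _ _).trans ((add_le_add ((abs_add_le _ _).trans (add_le_add
    ((abs_add_le _ _).trans (add_le_add t1 t2)) t3)) t4).trans ?_)
  have M30 : 0 ≤ M ^ 3 := by positivity
  nlinarith [mul_le_mul_of_nonneg_left M1 q0, mul_le_mul_of_nonneg_left M2 q0,
    mul_le_mul_of_nonneg_left M1 q1, mul_le_mul_of_nonneg_left M3 q2,
    mul_nonneg q0 M30, mul_nonneg q1 M30, mul_nonneg q2 M30]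

/-- The non-divergence part of the time derivative of the energy density. -/
def bulkTerm (s κ Λ a a' gv pv Rg Rp Qp Dg pr x₁ x₃ x₄ y₀ y₃ : ℝ) : ℝ :=
  -(x₄ + κ * y₃) * (s * x₃ + y₃ + gv * x₄ + Rg) + a * y₃ * (-(pv * x₄) - Rp)
    - 1 / 2 * (s * a') * y₃ ^ 2 + κ * x₃ * (s * y₃ - Qp)
    + Λ * (-(x₁ * Dg) - y₀ * (a * pr) - 1 / 2 * (s * a') * y₀ ^ 2)

lemma mul_le_young {C η u v : ℝ} (hη : 0 < η) :
    C * (|u| * |v|) ≤ η * u ^ 2 + C ^ 2 / (4 * η) * v ^ 2 := by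
  have h : 0 ≤ (2 * η * |u| - C * |v|) ^ 2 / (4 * η) := by positivity
  have e : (2 * η * |u| - C * |v|) ^ 2 / (4 * η)
      = η * |u| ^ 2 + C ^ 2 / (4 * η) * |v| ^ 2 - C * (|u| * |v|) := by
    field_simp
    ring
  rw [e, sq_abs, sq_abs] at h
  linarith

lemma bulkTerm_le {C c κ Λ δ s a a' gv pv Rg Rp Qp Dg pr x₁ x₂ x₃ x₄ y₀ y₃ : ℝ}
    (hC : 1 ≤ C) (hc : 0 < c) (hκ : 0 < κ) (hκ1 : κ ≤ 1) (hκc : 16 * C ^ 2 * κ ≤ c)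
    (hδκ : δ ≤ κ) (hδc : 2 * C * δ ≤ c) (hΛ : 0 ≤ Λ)
    (hs : |s| ≤ C) (hgv : c ≤ gv) (hgC : |gv| ≤ C)
    (hRg : |Rg| ≤ C * (|x₁| + |x₂| + |x₃|)) (hRp : |Rp| ≤ C * (|x₁| + |x₂| + |x₃|))
    (hQp : |Qp| ≤ C * (|x₁| + |x₂| + |x₃|)) (ha : |a| ≤ C) (hsa : 0 ≤ s * a')
    (hapv : |-(a * pv) - 1| ≤ C * |x₁|) (hDg : c * x₁ ^ 2 ≤ x₁ * Dg)
    (hpr : |a * pr| ≤ C * x₁ ^ 2) (hx₁ : |x₁| ≤ δ) (hy₀ : |y₀| ≤ δ) :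
    bulkTerm s κ Λ a a' gv pv Rg Rp Qp Dg pr x₁ x₃ x₄ y₀ y₃
      ≤ -(c / 2) * x₄ ^ 2 - κ / 2 * y₃ ^ 2
        + 3 * (8 * C ^ 2 / c + 16 * C ^ 4 / κ + C) * (x₁ ^ 2 + x₂ ^ 2 + x₃ ^ 2)
        - Λ * (c / 2) * x₁ ^ 2 := by
  have hC0 : 0 < C := by linarith
  have hδ0 : 0 ≤ δ := (abs_nonneg _).trans hx₁
  set S := |x₁| + |x₂| + |x₃| with hS
  have hS0 : 0 ≤ S := by positivity
  have hx₃S : |x₃| ≤ S := by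
    rw [hS]
    linarith [abs_nonneg x₁, abs_nonneg x₂]
  have hS2 : S ^ 2 ≤ 3 * (x₁ ^ 2 + x₂ ^ 2 + x₃ ^ 2) := by
    rw [← sq_abs x₁, ← sq_abs x₂, ← sq_abs x₃, hS]
    nlinarith [sq_nonneg (|x₁| - |x₂|), sq_nonneg (|x₂| - |x₃|), sq_nonneg (|x₁| - |x₃|)]
  have X0 := abs_nonneg x₄
  have Y0 := abs_nonneg y₃
  have CC : C ≤ C ^ 2 := le_self_pow₀ hC (by norm_num)
  have b1 : -(x₄ * (s * x₃)) ≤ C * (|x₄| * S) := by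
    refine (neg_le_abs _).trans ?_
    rw [abs_mul, abs_mul]
    calc |x₄| * (|s| * |x₃|) ≤ |x₄| * (C * S) := by gcongr
      _ = _ := by ring
  have b2 : -(x₄ * Rg) ≤ C * (|x₄| * S) := by
    refine (neg_le_abs _).trans ?_
    rw [abs_mul]
    calc |x₄| * |Rg| ≤ |x₄| * (C * S) := by gcongr
      _ = _ := by ring
  have b3 : (-(a * pv) - 1) * (x₄ * y₃) ≤ C * κ * (|y₃| * |x₄|) := by
    refine (le_abs_self _).trans ?_
    rw [abs_mul, abs_mul]
    calc |-(a * pv) - 1| * (|x₄| * |y₃|) ≤ (C * κ) * (|x₄| * |y₃|) := by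
          gcongr
          exact hapv.trans (by gcongr; exact hx₁.trans hδκ)
      _ = _ := by ring
  have b4 : -(κ * y₃ * (s * x₃)) ≤ C ^ 2 * (|y₃| * S) := by
    refine (neg_le_abs _).trans ?_
    rw [abs_mul, abs_mul, abs_mul, abs_of_pos hκ]
    calc κ * |y₃| * (|s| * |x₃|) ≤ 1 * |y₃| * (C * S) := by gcongr
      _ = C * (|y₃| * S) := by ring
      _ ≤ _ := by gcongr
  have b5 : -(κ * y₃ * (gv * x₄)) ≤ C * κ * (|y₃| * |x₄|) := by
    refine (neg_le_abs _).trans ?_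
    rw [abs_mul, abs_mul, abs_mul, abs_of_pos hκ]
    calc κ * |y₃| * (|gv| * |x₄|) ≤ κ * |y₃| * (C * |x₄|) := by gcongr
      _ = _ := by ring
  have b6 : -(κ * y₃ * Rg) ≤ C ^ 2 * (|y₃| * S) := by
    refine (neg_le_abs _).trans ?_
    rw [abs_mul, abs_mul, abs_of_pos hκ]
    calc κ * |y₃| * |Rg| ≤ 1 * |y₃| * (C * S) := by gcongr
      _ = C * (|y₃| * S) := by ring
      _ ≤ _ := by gcongr
  have b7 : -(a * y₃ * Rp) ≤ C ^ 2 * (|y₃| * S) := by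
    refine (neg_le_abs _).trans ?_
    rw [abs_mul, abs_mul]
    calc |a| * |y₃| * |Rp| ≤ C * |y₃| * (C * S) := by gcongr
      _ = _ := by ring
  have b8 : κ * x₃ * (s * y₃) ≤ C ^ 2 * (|y₃| * S) := by
    refine (le_abs_self _).trans ?_
    rw [abs_mul, abs_mul, abs_mul, abs_of_pos hκ]
    calc κ * |x₃| * (|s| * |y₃|) ≤ 1 * S * (C * |y₃|) := by gcongr
      _ = C * (|y₃| * S) := by ring
      _ ≤ _ := by gcongr
  have b9 : -(κ * x₃ * Qp) ≤ C * S ^ 2 := by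
    refine (neg_le_abs _).trans ?_
    rw [abs_mul, abs_mul, abs_of_pos hκ]
    calc κ * |x₃| * |Qp| ≤ 1 * S * (C * S) := by gcongr
      _ = _ := by ring
  have b10 : -(y₀ * (a * pr)) ≤ c / 2 * x₁ ^ 2 := by
    refine (neg_le_abs _).trans ?_
    rw [abs_mul]
    calc |y₀| * |a * pr| ≤ δ * (C * x₁ ^ 2) := by gcongr
      _ = (C * δ) * x₁ ^ 2 := by ring
      _ ≤ _ := by
        gcongr
        linarith
  have y1 := mul_le_young (C := 2 * C) (u := x₄) (v := S) (show 0 < c / 8 by positivity)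
  have y2 := mul_le_young (C := 4 * C ^ 2) (u := y₃) (v := S) (show 0 < κ / 4 by positivity)
  have y3 := mul_le_young (C := 2 * C * κ) (u := y₃) (v := x₄) (show 0 < κ / 4 by positivity)
  rw [abs_of_nonneg hS0] at y1 y2
  have e1 : (2 * C) ^ 2 / (4 * (c / 8)) = 8 * C ^ 2 / c := by
    field_simp
    ring
  have e2 : (4 * C ^ 2) ^ 2 / (4 * (κ / 4)) = 16 * C ^ 4 / κ := by
    field_simp
    ring
  have e3 : (2 * C * κ) ^ 2 / (4 * (κ / 4)) = 4 * C ^ 2 * κ := by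
    field_simp
    ring
  rw [e1] at y1
  rw [e2] at y2
  rw [e3] at y3
  have g1 : c * x₄ ^ 2 ≤ gv * x₄ ^ 2 := by gcongr
  have d1 : 0 ≤ s * a' * y₃ ^ 2 := by positivity
  have d2 : 0 ≤ s * a' * y₀ ^ 2 := by positivity
  have k1 : 4 * C ^ 2 * κ * x₄ ^ 2 ≤ c / 4 * x₄ ^ 2 := by
    gcongr
    linarith
  have zero : Λ * (-(x₁ * Dg) - y₀ * (a * pr) - 1 / 2 * (s * a') * y₀ ^ 2)
      ≤ Λ * (-(c / 2 * x₁ ^ 2)) := by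
    gcongr
    linarith
  have m1 : (8 * C ^ 2 / c + 16 * C ^ 4 / κ + C) * S ^ 2
      ≤ (8 * C ^ 2 / c + 16 * C ^ 4 / κ + C) * (3 * (x₁ ^ 2 + x₂ ^ 2 + x₃ ^ 2)) := by
    gcongr
  have x4p := sq_nonneg x₄
  have e : bulkTerm s κ Λ a a' gv pv Rg Rp Qp Dg pr x₁ x₃ x₄ y₀ y₃
      = -(x₄ * (s * x₃)) + -(x₄ * Rg) + (-(a * pv) - 1) * (x₄ * y₃) + -(κ * y₃ * (s * x₃))
        + -(κ * y₃ * (gv * x₄)) + -(κ * y₃ * Rg) + -(a * y₃ * Rp) + κ * x₃ * (s * y₃)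
        + -(κ * x₃ * Qp) - gv * x₄ ^ 2 - κ * y₃ ^ 2 - 1 / 2 * (s * a' * y₃ ^ 2)
        + Λ * (-(x₁ * Dg) - y₀ * (a * pr) - 1 / 2 * (s * a') * y₀ ^ 2) := by
    simp only [bulkTerm]
    ring
  rw [e]
  have hcx : 0 ≤ c * x₄ ^ 2 := by positivity
  linarith

lemma abs_bulkTerm_le {C κ Λ s a a' gv pv Rg Rp Qp Dg pr x₁ x₂ x₃ x₄ y₀ y₃ n : ℝ}
    (hC : 1 ≤ C) (hκ : 0 < κ) (hκ1 : κ ≤ 1) (hΛ : 0 ≤ Λ) (hn : 0 ≤ n)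
    (hs : |s| ≤ C) (hgC : |gv| ≤ C) (hpC : |pv| ≤ C)
    (hRg : |Rg| ≤ C * (|x₁| + |x₂| + |x₃|)) (hRp : |Rp| ≤ C * (|x₁| + |x₂| + |x₃|))
    (hQp : |Qp| ≤ C * (|x₁| + |x₂| + |x₃|)) (ha : |a| ≤ C) (hsa : |s * a'| ≤ C)
    (hDg : |Dg| ≤ C * |x₁|) (hpr : |a * pr| ≤ C * x₁ ^ 2) (hx₁ : |x₁| ≤ 1)
    (h1 : |x₁| ≤ n) (h2 : |x₂| ≤ n) (h3 : |x₃| ≤ n) (h4 : |x₄| ≤ n) (h5 : |y₀| ≤ n)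
    (h6 : |y₃| ≤ n) :
    |bulkTerm s κ Λ a a' gv pv Rg Rp Qp Dg pr x₁ x₃ x₄ y₀ y₃|
      ≤ (30 + 3 * Λ) * C ^ 2 * n ^ 2 := by
  have hC0 : 0 ≤ C := by linarith
  have CC : C ≤ C ^ 2 := le_self_pow₀ hC (by norm_num)
  have C1 : 1 ≤ C ^ 2 := one_le_pow₀ hC
  have hS : C * (|x₁| + |x₂| + |x₃|) ≤ C * (3 * n) := by
    gcongr
    linarith
  have rg := hRg.trans hS
  have rp := hRp.trans hS
  have qp := hQp.trans hS
  have t1 : |-(x₄ + κ * y₃) * (s * x₃ + y₃ + gv * x₄ + Rg)|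
      ≤ (n + 1 * n) * (C * n + n + C * n + C * (3 * n)) := by
    rw [abs_mul, abs_neg]
    gcongr
    · refine (abs_add_le _ _).trans (add_le_add h4 ?_)
      rw [abs_mul, abs_of_pos hκ]
      gcongr
    · refine (abs_add_le _ _).trans (add_le_add ((abs_add_le _ _).trans (add_le_add
        ((abs_add_le _ _).trans (add_le_add ?_ h6)) ?_)) rg)
      · rw [abs_mul]
        gcongr
      · rw [abs_mul]
        gcongr
  have t2 : |a * y₃ * (-(pv * x₄) - Rp)| ≤ C * n * (C * n + C * (3 * n)) := by
    rw [abs_mul, abs_mul]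
    gcongr
    refine (abs_sub _ _).trans (add_le_add ?_ rp)
    rw [abs_neg, abs_mul]
    gcongr
  have t3 : |1 / 2 * (s * a') * y₃ ^ 2| ≤ 1 / 2 * C * n ^ 2 := by
    rw [abs_mul, abs_mul, abs_pow, abs_of_pos (by norm_num : (0:ℝ) < 1 / 2)]
    gcongr
  have t4 : |κ * x₃ * (s * y₃ - Qp)| ≤ 1 * n * (C * n + C * (3 * n)) := by
    rw [abs_mul, abs_mul, abs_of_pos hκ]
    gcongr
    refine (abs_sub _ _).trans (add_le_add ?_ qp)
    rw [abs_mul]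
    gcongr
  have t5 : |Λ * (-(x₁ * Dg) - y₀ * (a * pr) - 1 / 2 * (s * a') * y₀ ^ 2)|
      ≤ Λ * (n * (C * n) + n * (C * n) + 1 / 2 * C * n ^ 2) := by
    rw [abs_mul, abs_of_nonneg hΛ]
    gcongr
    refine (abs_sub _ _).trans (add_le_add ((abs_sub _ _).trans (add_le_add ?_ ?_)) ?_)
    · rw [abs_neg, abs_mul]
      gcongr
      exact hDg.trans (by gcongr)
    · rw [abs_mul]
      gcongr
      refine hpr.trans ?_
      rw [← sq_abs]
      gcongr
      nlinarith [abs_nonneg x₁]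
    · rw [abs_mul, abs_mul, abs_pow, abs_of_pos (by norm_num : (0:ℝ) < 1 / 2)]
      gcongr
  unfold bulkTerm
  refine (abs_add_le _ _).trans ((add_le_add ((abs_add_le _ _).trans (add_le_add
    ((abs_sub _ _).trans (add_le_add ((abs_add_le _ _).trans
      (add_le_add t1 t2)) t3)) t4)) t5).trans ?_)
  have n2 : 0 ≤ n ^ 2 := by positivity
  have u1 := mul_le_mul_of_nonneg_right CC n2
  have u2 := mul_le_mul_of_nonneg_right C1 n2
  have u3 := mul_le_mul_of_nonneg_left u1 hΛ
  nlinarith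

/-- The weight `-1 / p'(ṽ)` and its spatial derivative. -/
def profileWeight (p tv : ℝ → ℝ) (ξ : ℝ) : ℝ := -(iteratedDeriv 1 p (tv ξ))⁻¹

def profileWeight' (p tv : ℝ → ℝ) (ξ : ℝ) : ℝ :=
  iteratedDeriv 2 p (tv ξ) * iteratedDeriv 1 tv ξ / iteratedDeriv 1 p (tv ξ) ^ 2

lemma exists_pos_lower_bound {F : ℝ → ℝ} {l u : ℝ} (hF : ContinuousOn F (Icc l u))
    (hpos : ∀ z ∈ Icc l u, 0 < F z) : ∃ c > 0, ∀ z ∈ Icc l u, c ≤ F z := by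
  rcases (Icc l u).eq_empty_or_nonempty with h | h
  · exact ⟨1, one_pos, by simp [h]⟩
  · obtain ⟨x, hx, hmin⟩ := isCompact_Icc.exists_isMinOn h hF
    exact ⟨F x, hpos x hx, fun z hz => hmin hz⟩

/-- Uniform bounds on the coefficients of the perturbation system, for perturbations
`φ 0` of the profile `w 0` (with derivatives `φ k`, `w k`) that stay small. -/
structure CoefficientBounds (p g tv : ℝ → ℝ) (s vp C c : ℝ) : Prop where
  one_le : 1 ≤ C
  pos : 0 < c
  abs_speed_le : |s| ≤ C
  weight : ∀ ξ, c ≤ profileWeight p tv ξ ∧ profileWeight p tv ξ ≤ C ∧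
    0 ≤ s * profileWeight' p tv ξ ∧ |s * profileWeight' p tv ξ| ≤ C
  nonlinear : ∀ ξ (w φ : ℕ → ℝ), (∀ k, w k = iteratedDeriv k tv ξ) → |φ 0| ≤ vp / 2 → |φ 1| ≤ 1 →
    0 < w 0 + φ 0 ∧ c ≤ iteratedDeriv 1 g (w 0 + φ 0) ∧
    |iteratedDeriv 1 g (w 0 + φ 0)| ≤ C ∧ |iteratedDeriv 1 p (w 0 + φ 0)| ≤ C ∧
    |chainDeriv₃ g (fun k => w k + φ k) - chainDeriv₃ g w
      - iteratedDeriv 1 g (w 0 + φ 0) * φ 3| ≤ C * (|φ 0| + |φ 1| + |φ 2|) ∧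
    |chainDeriv₃ p (fun k => w k + φ k) - chainDeriv₃ p w
      - iteratedDeriv 1 p (w 0 + φ 0) * φ 3| ≤ C * (|φ 0| + |φ 1| + |φ 2|) ∧
    |chainDeriv₂ p (fun k => w k + φ k) - chainDeriv₂ p w|
      ≤ C * (|φ 0| + |φ 1| + |φ 2|) ∧
    |-(profileWeight p tv ξ * iteratedDeriv 1 p (w 0 + φ 0)) - 1| ≤ C * |φ 0| ∧
    c * φ 0 ^ 2 ≤ φ 0 * (g (w 0 + φ 0) - g (w 0)) ∧
    |g (w 0 + φ 0) - g (w 0)| ≤ C * |φ 0| ∧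
    |profileWeight p tv ξ *
      (p (w 0 + φ 0) - p (w 0) - iteratedDeriv 1 p (w 0) * φ 0)| ≤ C * φ 0 ^ 2

lemma exists_coefficient_bounds {p g tv : ℝ → ℝ} {s vp vm : ℝ}
    (hp : ContDiffOn ℝ (⊤ : ℕ∞) p (Ioi 0)) (hg : ContDiffOn ℝ (⊤ : ℕ∞) g (Ioi 0))
    (hpd : ∀ v > 0, iteratedDeriv 1 p v < 0) (hpdd : ∀ v > 0, 0 ≤ iteratedDeriv 2 p v)
    (hgd : ∀ v > 0, 0 < iteratedDeriv 1 g v) (hs : s < 0) (hvp : 0 < vp)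
    (htv_mem : ∀ ξ, tv ξ ∈ Ioo vp vm) (htv_dec : ∀ ξ, iteratedDeriv 1 tv ξ < 0)
    (htv_bdd : ∀ k : ℕ, ∃ M : ℝ, ∀ ξ : ℝ, |iteratedDeriv k tv ξ| ≤ M) :
    ∃ C c : ℝ, CoefficientBounds p g tv s vp C c := by
  set l := vp / 2 with hl_def
  set u := vm + vp / 2 with hu_def
  have hl : 0 < l := by positivity
  obtain ⟨Cp, hCp0, hCp⟩ := exists_bound_iteratedDeriv hp hl u
  obtain ⟨Cg, hCg0, hCg⟩ := exists_bound_iteratedDeriv hg hl u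
  obtain ⟨c₁, hc₁, hgc⟩ := exists_pos_lower_bound (F := iteratedDeriv 1 g) (l := l) (u := u)
    ((contDiffOn_iteratedDeriv hg 1).continuousOn.mono fun z hz => hl.trans_le hz.1)
    (fun z hz => hgd z (hl.trans_le hz.1))
  obtain ⟨c₂, hc₂, hpc⟩ := exists_pos_lower_bound (F := fun z => -iteratedDeriv 1 p z) (l := l)
    (u := u)
    (((contDiffOn_iteratedDeriv hp 1).continuousOn.mono fun z hz => hl.trans_le hz.1).neg)
    (fun z hz => neg_pos.2 (hpd z (hl.trans_le hz.1)))
  choose m hm using htv_bdd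
  obtain ⟨M, hM1, hM⟩ : ∃ M : ℝ, 1 ≤ M ∧ ∀ k ≤ 3, ∀ ξ, |iteratedDeriv k tv ξ| ≤ M := by
    refine ⟨1 + ∑ k ∈ Finset.range 4, |m k|, le_add_of_nonneg_right
      (Finset.sum_nonneg fun _ _ => abs_nonneg _), fun k hk ξ => ?_⟩
    have := Finset.single_le_sum (f := fun k => |m k|) (fun _ _ => abs_nonneg _)
      (Finset.mem_range.2 (by omega : k < 4))
    have h2 := (hm k ξ).trans (le_abs_self _)
    linarith
  have mem0 : ∀ ξ, tv ξ ∈ Icc l u := fun ξ =>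
    ⟨by linarith [(htv_mem ξ).1], by linarith [(htv_mem ξ).2]⟩
  have hCppos : 0 < Cp := by
    have h1 := hpc _ (mem0 0)
    have h2 := hCp 1 (by norm_num) _ (mem0 0)
    have h3 := neg_le_abs (iteratedDeriv 1 p (tv 0))
    linarith
  have M0 : 0 ≤ M := by linarith
  obtain ⟨C, h1, h2, h3, h4, h5, h6, h7, h8, h9⟩ : ∃ C : ℝ, 1 ≤ C ∧ |s| ≤ C ∧ 1 / c₂ ≤ C ∧
      |s| * (Cp * M / c₂ ^ 2) ≤ C ∧ Cp ≤ C ∧ Cg ≤ C ∧ 40 * Cg * M ^ 3 ≤ C ∧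
      40 * Cp * M ^ 3 ≤ C ∧ Cp / c₂ ≤ C := by
    have e1 : 0 ≤ |s| := abs_nonneg s
    have e2 : 0 ≤ 1 / c₂ := by positivity
    have e3 : 0 ≤ |s| * (Cp * M / c₂ ^ 2) := by positivity
    have e4 : 0 ≤ 40 * Cg * M ^ 3 := by positivity
    have e5 : 0 ≤ 40 * Cp * M ^ 3 := by positivity
    have e6 : 0 ≤ Cp / c₂ := by positivity
    refine ⟨1 + |s| + 1 / c₂ + |s| * (Cp * M / c₂ ^ 2) + Cp + Cg + 40 * Cg * M ^ 3
      + 40 * Cp * M ^ 3 + Cp / c₂, ?_, ?_, ?_, ?_, ?_, ?_, ?_, ?_, ?_⟩ <;> linarith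
  have hw0 : ∀ ξ, 0 < profileWeight p tv ξ ∧ profileWeight p tv ξ ≤ 1 / c₂ ∧
      1 / Cp ≤ profileWeight p tv ξ := by
    intro ξ
    have e : profileWeight p tv ξ = 1 / (-iteratedDeriv 1 p (tv ξ)) := by
      rw [profileWeight, one_div, inv_neg]
    have hlow := hpc _ (mem0 ξ)
    have hup := (neg_le_abs _).trans (hCp 1 (by norm_num) _ (mem0 ξ))
    have hpos : 0 < -iteratedDeriv 1 p (tv ξ) := hc₂.trans_le hlow
    rw [e]
    exact ⟨by positivity, one_div_le_one_div_of_le hc₂ hlow, one_div_le_one_div_of_le hpos hup⟩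
  refine ⟨C, min c₁ (1 / Cp), h1, lt_min hc₁ (by positivity), h2, fun ξ => ?_, ?_⟩
  · obtain ⟨a0, a1, a2⟩ := hw0 ξ
    have hpos : 0 < tv ξ := hvp.trans (htv_mem ξ).1
    refine ⟨(min_le_right _ _).trans a2, a1.trans h3, ?_, ?_⟩
    · have : profileWeight' p tv ξ ≤ 0 := by
        apply div_nonpos_of_nonpos_of_nonneg _ (sq_nonneg _)
        exact mul_nonpos_of_nonneg_of_nonpos (hpdd _ hpos) (htv_dec ξ).le
      exact mul_nonneg_of_nonpos_of_nonpos hs.le this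
    · refine le_trans ?_ h4
      rw [abs_mul, profileWeight', abs_div, abs_mul, abs_pow]
      have q1 := hCp 2 (by norm_num) _ (mem0 ξ)
      have q2 := hM 1 (by norm_num) ξ
      have q3 := (hpc _ (mem0 ξ)).trans (neg_le_abs (iteratedDeriv 1 p (tv ξ)))
      gcongr
  · intro ξ w φ hw hφ0 hφ1
    have hw0' : w 0 = tv ξ := by rw [hw, iteratedDeriv_zero]
    have hmem0 : w 0 ∈ Icc l u := hw0' ▸ mem0 ξ
    have hmem1 : w 0 + φ 0 ∈ Icc l u := by
      have := htv_mem ξ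
      rw [← hw0'] at this
      obtain ⟨q1, q2⟩ := abs_le.1 hφ0
      exact ⟨by linarith [this.1], by linarith [this.2]⟩
    have hwM : ∀ k ≤ 3, |w k| ≤ M := fun k hk => hw k ▸ hM k hk ξ
    have S0 : 0 ≤ |φ 0| + |φ 1| + |φ 2| := by positivity
    obtain ⟨a0, a1, -⟩ := hw0 ξ
    refine ⟨hl.trans_le hmem1.1, (min_le_left _ _).trans (hgc _ hmem1),
      (hCg 1 (by norm_num) _ hmem1).trans h6, (hCp 1 (by norm_num) _ hmem1).trans h5,
      (abs_chainDeriv₃_sub_le hg hl hCg0 hCg hM1 hwM hφ1 hmem0 hmem1).trans ?_,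
      (abs_chainDeriv₃_sub_le hp hl hCp0 hCp hM1 hwM hφ1 hmem0 hmem1).trans ?_,
      (abs_chainDeriv₂_sub_le hp hl hCp0 hCp hM1 hwM hφ1 hmem0 hmem1).trans ?_, ?_, ?_, ?_, ?_⟩
    · gcongr
    · gcongr
    · gcongr
    · have hne : iteratedDeriv 1 p (w 0) ≠ 0 := by
        rw [hw0']
        exact (hpd _ (hvp.trans (htv_mem ξ).1)).ne
      have e : -(profileWeight p tv ξ * iteratedDeriv 1 p (w 0 + φ 0)) - 1
          = -(profileWeight p tv ξ
            * (iteratedDeriv 1 p (w 0 + φ 0) - iteratedDeriv 1 p (w 0))) := by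
        rw [profileWeight, ← hw0']
        field_simp
      have q := abs_iteratedDeriv_sub_le hp hl hCp (k := 1) (by norm_num) hmem0 hmem1
      rw [add_sub_cancel_left] at q
      rw [e, abs_neg, abs_mul, abs_of_pos a0]
      calc profileWeight p tv ξ * |iteratedDeriv 1 p (w 0 + φ 0) - iteratedDeriv 1 p (w 0)|
          ≤ 1 / c₂ * (Cp * |φ 0|) := by gcongr
        _ = Cp / c₂ * |φ 0| := by ring
        _ ≤ C * |φ 0| := by gcongr
    · obtain ⟨x, hx, -, e⟩ := exists_mean_value (F := g) (F' := iteratedDeriv 1 g)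
        (fun x hx => by simpa using hasDerivAt_iteratedDeriv_of_pos hg 0 (hl.trans_le hx.1))
        hmem0 hmem1
      rw [e, add_sub_cancel_left]
      have : min c₁ (1 / Cp) ≤ iteratedDeriv 1 g x := (min_le_left _ _).trans (hgc _ hx)
      nlinarith [mul_le_mul_of_nonneg_right this (sq_nonneg (φ 0))]
    · have q := abs_iteratedDeriv_sub_le hg hl hCg (k := 0) (by norm_num) hmem0 hmem1
      simp only [iteratedDeriv_zero, add_sub_cancel_left] at q
      exact q.trans (by gcongr)
    · obtain ⟨x, hx, hd, e⟩ := exists_mean_value (F := p) (F' := iteratedDeriv 1 p)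
        (fun x hx => by simpa using hasDerivAt_iteratedDeriv_of_pos hp 0 (hl.trans_le hx.1))
        hmem0 hmem1
      rw [add_sub_cancel_left] at hd
      have q := abs_iteratedDeriv_sub_le hp hl hCp (k := 1) (by norm_num) hmem0 hx
      rw [e, add_sub_cancel_left, ← sub_mul, abs_mul, abs_mul, abs_of_pos a0]
      calc profileWeight p tv ξ * (|iteratedDeriv 1 p x - iteratedDeriv 1 p (w 0)| * |φ 0|)
          ≤ 1 / c₂ * ((Cp * |φ 0|) * |φ 0|) := by
            gcongr
            exact q.trans (by gcongr)
        _ = Cp / c₂ * |φ 0| ^ 2 := by ring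
        _ ≤ C * φ 0 ^ 2 := by
            rw [sq_abs]
            gcongr

/-- The time derivative of the `j`-th spatial derivative. -/
def timeDeriv (Φ : ℝ → ℝ → ℝ) (j : ℕ) (t ξ : ℝ) : ℝ :=
  deriv (fun τ => iteratedDeriv j (Φ τ) ξ) t

/-- The spatial derivatives of `v = ṽ + Φ_ξ`. -/
def totalDeriv (tv φ : ℝ → ℝ) (ξ : ℝ) (k : ℕ) : ℝ :=
  iteratedDeriv k tv ξ + iteratedDeriv (k + 1) φ ξ

lemma hasDerivAt_timeDeriv {Φ : ℝ → ℝ → ℝ} {T : ℝ} (hT : 0 < T)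
    (reg : ∀ t ∈ Icc (0:ℝ) T, ContDiff ℝ 4 (Φ t))
    (diff : ∀ j : ℕ, j ≤ 3 → ∀ t ∈ Icc (0:ℝ) T, ∀ ξ : ℝ,
      DifferentiableAt ℝ (fun τ => iteratedDeriv j (Φ τ) ξ) t)
    (cont : ∀ j : ℕ, j ≤ 3 → ContinuousOn
      (fun q : ℝ × ℝ => deriv (fun τ => iteratedDeriv j (Φ τ) q.2) q.1)
      (Icc (0:ℝ) T ×ˢ (univ : Set ℝ)))
    {j : ℕ} (hj : j < 3) {t : ℝ} (ht : t ∈ Icc (0:ℝ) T) (ξ : ℝ) :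
    HasDerivAt (timeDeriv Φ j t) (timeDeriv Φ (j + 1) t ξ) ξ :=
  hasDerivAt_swap (u := fun τ ξ => iteratedDeriv j (Φ τ) ξ)
    (w := fun τ ξ => iteratedDeriv (j + 1) (Φ τ) ξ) (Du := timeDeriv Φ j)
    (Dw := timeDeriv Φ (j + 1)) hT
    (fun τ hτ ξ => (diff j (by omega) τ hτ ξ).hasDerivAt)
    (fun τ hτ ξ => (diff (j + 1) (by omega) τ hτ ξ).hasDerivAt)
    (fun τ hτ ξ => hasDerivAt_iteratedDeriv (n := 4) (reg τ hτ) (by omega) ξ)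
    (fun τ hτ => (reg τ hτ).continuous_iteratedDeriv (j + 1)
      (by norm_cast; omega))
    (cont j (by omega)) (cont (j + 1) (by omega)) t ht ξ

lemma IsClassicalSolution.timeDeriv_eq {p g tv : ℝ → ℝ} {s T : ℝ} {Φ Ψ : ℝ → ℝ → ℝ}
    (sol : IsClassicalSolution p g tv s T Φ Ψ) (hT : 0 < T)
    (hp : ContDiffOn ℝ (⊤ : ℕ∞) p (Ioi 0)) (hg : ContDiffOn ℝ (⊤ : ℕ∞) g (Ioi 0))
    (htv : ContDiff ℝ (⊤ : ℕ∞) tv) (htv_pos : ∀ ξ, 0 < tv ξ) {t : ℝ} (ht : t ∈ Icc (0:ℝ) T)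
    (hpos : ∀ ξ, 0 < totalDeriv tv (Φ t) ξ 0) (ξ : ℝ) :
    timeDeriv Φ 0 t ξ = s * iteratedDeriv 1 (Φ t) ξ + iteratedDeriv 1 (Ψ t) ξ
        + (chainDeriv₁ g (totalDeriv tv (Φ t) ξ) - chainDeriv₁ g fun k => iteratedDeriv k tv ξ) ∧
    timeDeriv Ψ 0 t ξ = s * iteratedDeriv 1 (Ψ t) ξ
        - (p (totalDeriv tv (Φ t) ξ 0) - p (tv ξ)) ∧
    timeDeriv Φ 2 t ξ = s * iteratedDeriv 3 (Φ t) ξ + iteratedDeriv 3 (Ψ t) ξ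
        + (chainDeriv₃ g (totalDeriv tv (Φ t) ξ) - chainDeriv₃ g fun k => iteratedDeriv k tv ξ) ∧
    timeDeriv Ψ 2 t ξ = s * iteratedDeriv 3 (Ψ t) ξ
        - (chainDeriv₂ p (totalDeriv tv (Φ t) ξ) - chainDeriv₂ p fun k => iteratedDeriv k tv ξ) ∧
    timeDeriv Ψ 3 t ξ = s * iteratedDeriv 4 (Ψ t) ξ
        - (chainDeriv₃ p (totalDeriv tv (Φ t) ξ)
          - chainDeriv₃ p fun k => iteratedDeriv k tv ξ) := by
  have hΦ : ∀ j < 4, ∀ ξ, HasDerivAt (iteratedDeriv j (Φ t)) (iteratedDeriv (j + 1) (Φ t) ξ) ξ :=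
    fun j hj ξ => hasDerivAt_iteratedDeriv (n := 4) (sol.regΦ t ht) hj ξ
  have hΨ : ∀ j < 4, ∀ ξ, HasDerivAt (iteratedDeriv j (Ψ t)) (iteratedDeriv (j + 1) (Ψ t) ξ) ξ :=
    fun j hj ξ => hasDerivAt_iteratedDeriv (n := 4) (sol.regΨ t ht) hj ξ
  have hw : ∀ ξ, ∀ k < 3, HasDerivAt (iteratedDeriv k tv) (iteratedDeriv (k + 1) tv ξ) ξ :=
    fun ξ k hk => hasDerivAt_iteratedDeriv (contDiff_infty.1 htv 4) (by omega) ξ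
  have hv : ∀ ξ, ∀ k < 3, HasDerivAt (fun x => totalDeriv tv (Φ t) x k)
      (totalDeriv tv (Φ t) ξ (k + 1)) ξ :=
    fun ξ k hk => (hw ξ k hk).add (hΦ (k + 1) (by omega) ξ)
  have dΦ : ∀ j < 3, ∀ ξ, HasDerivAt (timeDeriv Φ j t) (timeDeriv Φ (j + 1) t ξ) ξ :=
    fun j hj ξ => hasDerivAt_timeDeriv hT sol.regΦ sol.tdiffΦ sol.mixContΦ hj ht ξ
  have dΨ : ∀ j < 3, ∀ ξ, HasDerivAt (timeDeriv Ψ j t) (timeDeriv Ψ (j + 1) t ξ) ξ :=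
    fun j hj ξ => hasDerivAt_timeDeriv hT sol.regΨ sol.tdiffΨ sol.mixContΨ hj ht ξ
  have hw0 : ∀ ξ, 0 < iteratedDeriv 0 tv ξ := by simpa using htv_pos
  have w1 : ∀ {F : ℝ → ℝ}, ContDiffOn ℝ (⊤ : ℕ∞) F (Ioi 0) → ∀ ξ,
      HasDerivAt (fun x => F (tv x)) (chainDeriv₁ F fun k => iteratedDeriv k tv ξ) ξ := by
    intro F hF ξ
    simpa using hasDerivAt_comp_chainDeriv₁ (w := fun k x => iteratedDeriv k tv x) hF (hw0 ξ)
      (hw ξ)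
  have w2 : ∀ {F : ℝ → ℝ}, ContDiffOn ℝ (⊤ : ℕ∞) F (Ioi 0) → ∀ ξ,
      HasDerivAt (fun x => chainDeriv₁ F fun k => iteratedDeriv k tv x)
        (chainDeriv₂ F fun k => iteratedDeriv k tv ξ) ξ := fun hF ξ =>
    hasDerivAt_chainDeriv₁ (w := fun k x => iteratedDeriv k tv x) hF (hw0 ξ) (hw ξ)
  have w3 : ∀ {F : ℝ → ℝ}, ContDiffOn ℝ (⊤ : ℕ∞) F (Ioi 0) → ∀ ξ,
      HasDerivAt (fun x => chainDeriv₂ F fun k => iteratedDeriv k tv x)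
        (chainDeriv₃ F fun k => iteratedDeriv k tv ξ) ξ := fun hF ξ =>
    hasDerivAt_chainDeriv₂ (w := fun k x => iteratedDeriv k tv x) hF (hw0 ξ) (hw ξ)
  have v1 : ∀ {F : ℝ → ℝ}, ContDiffOn ℝ (⊤ : ℕ∞) F (Ioi 0) → ∀ ξ,
      HasDerivAt (fun x => F (totalDeriv tv (Φ t) x 0))
        (chainDeriv₁ F (totalDeriv tv (Φ t) ξ)) ξ := fun hF ξ =>
    hasDerivAt_comp_chainDeriv₁ (w := fun k x => totalDeriv tv (Φ t) x k) hF (hpos ξ) (hv ξ)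
  have v2 : ∀ {F : ℝ → ℝ}, ContDiffOn ℝ (⊤ : ℕ∞) F (Ioi 0) → ∀ ξ,
      HasDerivAt (fun x => chainDeriv₁ F (totalDeriv tv (Φ t) x))
        (chainDeriv₂ F (totalDeriv tv (Φ t) ξ)) ξ := fun hF ξ =>
    hasDerivAt_chainDeriv₁ (w := fun k x => totalDeriv tv (Φ t) x k) hF (hpos ξ) (hv ξ)
  have v3 : ∀ {F : ℝ → ℝ}, ContDiffOn ℝ (⊤ : ℕ∞) F (Ioi 0) → ∀ ξ,
      HasDerivAt (fun x => chainDeriv₂ F (totalDeriv tv (Φ t) x))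
        (chainDeriv₃ F (totalDeriv tv (Φ t) ξ)) ξ := fun hF ξ =>
    hasDerivAt_chainDeriv₂ (w := fun k x => totalDeriv tv (Φ t) x k) hF (hpos ξ) (hv ξ)
  have D0 : ∀ ξ, timeDeriv Φ 0 t ξ = s * iteratedDeriv 1 (Φ t) ξ + iteratedDeriv 1 (Ψ t) ξ
      + (chainDeriv₁ g (totalDeriv tv (Φ t) ξ)
        - chainDeriv₁ g fun k => iteratedDeriv k tv ξ) := by
    intro ξ
    have := sol.eq1 t ht ξ
    simp only [Gterm] at this
    simp only [timeDeriv, chainDeriv₁, totalDeriv, iteratedDeriv_zero, zero_add, iteratedDeriv_one]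
    linear_combination this
  have E0 : ∀ ξ, timeDeriv Ψ 0 t ξ = s * iteratedDeriv 1 (Ψ t) ξ
      - (p (totalDeriv tv (Φ t) ξ 0) - p (tv ξ)) := by
    intro ξ
    have := sol.eq2 t ht ξ
    simp only [prel] at this
    simp only [timeDeriv, totalDeriv, iteratedDeriv_zero, zero_add, iteratedDeriv_one]
    linear_combination this
  have D1 : ∀ ξ, timeDeriv Φ 1 t ξ = s * iteratedDeriv 2 (Φ t) ξ + iteratedDeriv 2 (Ψ t) ξ
      + (chainDeriv₂ g (totalDeriv tv (Φ t) ξ)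
        - chainDeriv₂ g fun k => iteratedDeriv k tv ξ) := by
    intro ξ
    have h := dΦ 0 (by norm_num) ξ
    rw [show timeDeriv Φ 0 t = _ from funext D0] at h
    exact h.unique ((((hΦ 1 (by norm_num) ξ).const_mul s).add (hΨ 1 (by norm_num) ξ)).add
      ((v2 hg ξ).sub (w2 hg ξ)))
  have D2 : ∀ ξ, timeDeriv Φ 2 t ξ = s * iteratedDeriv 3 (Φ t) ξ + iteratedDeriv 3 (Ψ t) ξ
      + (chainDeriv₃ g (totalDeriv tv (Φ t) ξ)
        - chainDeriv₃ g fun k => iteratedDeriv k tv ξ) := by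
    intro ξ
    have h := dΦ 1 (by norm_num) ξ
    rw [show timeDeriv Φ 1 t = _ from funext D1] at h
    exact h.unique ((((hΦ 2 (by norm_num) ξ).const_mul s).add (hΨ 2 (by norm_num) ξ)).add
      ((v3 hg ξ).sub (w3 hg ξ)))
  have E1 : ∀ ξ, timeDeriv Ψ 1 t ξ = s * iteratedDeriv 2 (Ψ t) ξ
      - (chainDeriv₁ p (totalDeriv tv (Φ t) ξ)
        - chainDeriv₁ p fun k => iteratedDeriv k tv ξ) := by
    intro ξ
    have h := dΨ 0 (by norm_num) ξ
    rw [show timeDeriv Ψ 0 t = _ from funext E0] at h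
    exact h.unique (((hΨ 1 (by norm_num) ξ).const_mul s).sub ((v1 hp ξ).sub (w1 hp ξ)))
  have E2 : ∀ ξ, timeDeriv Ψ 2 t ξ = s * iteratedDeriv 3 (Ψ t) ξ
      - (chainDeriv₂ p (totalDeriv tv (Φ t) ξ)
        - chainDeriv₂ p fun k => iteratedDeriv k tv ξ) := by
    intro ξ
    have h := dΨ 1 (by norm_num) ξ
    rw [show timeDeriv Ψ 1 t = _ from funext E1] at h
    exact h.unique (((hΨ 2 (by norm_num) ξ).const_mul s).sub ((v2 hp ξ).sub (w2 hp ξ)))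
  refine ⟨D0 ξ, E0 ξ, D2 ξ, E2 ξ, ?_⟩
  have h := dΨ 2 (by norm_num) ξ
  rw [show timeDeriv Ψ 2 t = _ from funext E2] at h
  exact h.unique (((hΨ 3 (by norm_num) ξ).const_mul s).sub ((v3 hp ξ).sub (w3 hp ξ)))

/-- Fixed-time regularity of a classical solution component. -/
structure SqIntegrableDerivs (φ : ℝ → ℝ) : Prop where
  contDiff : ContDiff ℝ 4 φ
  sq : ∀ j ≤ 4, Integrable fun ξ => iteratedDeriv j φ ξ ^ 2

lemma L2sq_nonneg (u : ℝ → ℝ) : 0 ≤ L2sq u := integral_nonneg fun _ => sq_nonneg _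

lemma HkSq_three (φ : ℝ → ℝ) : HkSq 3 φ = L2sq (iteratedDeriv 0 φ) + L2sq (iteratedDeriv 1 φ)
    + L2sq (iteratedDeriv 2 φ) + L2sq (iteratedDeriv 3 φ) := by
  simp [HkSq, Finset.sum_range_succ]

namespace SqIntegrableDerivs

variable {φ ψ : ℝ → ℝ}

lemma hasDerivAt (h : SqIntegrableDerivs φ) {j : ℕ} (hj : j < 4) (ξ : ℝ) :
    HasDerivAt (iteratedDeriv j φ) (iteratedDeriv (j + 1) φ ξ) ξ :=
  hasDerivAt_iteratedDeriv (n := 4) h.contDiff hj ξ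

lemma continuous (h : SqIntegrableDerivs φ) {j : ℕ} (hj : j ≤ 4) :
    Continuous (iteratedDeriv j φ) :=
  h.contDiff.continuous_iteratedDeriv j (by exact_mod_cast hj)

lemma L2sq_succ_le (h : SqIntegrableDerivs φ) {j : ℕ} (hj : j + 2 ≤ 4) {ε : ℝ} (hε : 0 < ε) :
    L2sq (iteratedDeriv (j + 1) φ)
      ≤ ε * L2sq (iteratedDeriv (j + 2) φ) + 1 / (4 * ε) * L2sq (iteratedDeriv j φ) :=
  integral_sq_deriv_le (h.hasDerivAt (by omega)) (h.hasDerivAt (by omega)) (h.continuous hj)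
    (h.sq j (by omega)) (h.sq (j + 1) (by omega)) (h.sq (j + 2) hj) hε

lemma sq_le_HkSq (h : SqIntegrableDerivs φ) {j : ℕ} (hj : j ≤ 2) (ξ : ℝ) :
    iteratedDeriv j φ ξ ^ 2 ≤ HkSq 3 φ := by
  have key : iteratedDeriv j φ ξ ^ 2
      ≤ L2sq (iteratedDeriv j φ) + L2sq (iteratedDeriv (j + 1) φ) :=
    sq_le_integral_sq_add (h.hasDerivAt (by omega)) (h.continuous (by omega))
      (h.sq j (by omega)) (h.sq (j + 1) (by omega)) ξ
  rw [HkSq_three]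
  have n0 := L2sq_nonneg (iteratedDeriv 0 φ)
  have n1 := L2sq_nonneg (iteratedDeriv 1 φ)
  have n2 := L2sq_nonneg (iteratedDeriv 2 φ)
  have n3 := L2sq_nonneg (iteratedDeriv 3 φ)
  interval_cases j <;> norm_num only at key ⊢ <;> linarith

lemma abs_le_of_small (hφ : SqIntegrableDerivs φ) (hψ : SqIntegrableDerivs ψ) {δ : ℝ}
    (hδ : √(pairHkSq 3 φ ψ) ≤ δ) {j : ℕ} (hj : j ≤ 2) (ξ : ℝ) :
    |iteratedDeriv j φ ξ| ≤ δ ∧ |iteratedDeriv j ψ ξ| ≤ δ := by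
  have hδ0 : 0 ≤ δ := (Real.sqrt_nonneg _).trans hδ
  have h2 : pairHkSq 3 φ ψ ≤ δ ^ 2 := (Real.sqrt_le_left hδ0).1 hδ
  have nonneg : ∀ u, 0 ≤ HkSq 3 u := fun u => Finset.sum_nonneg fun _ _ => L2sq_nonneg _
  rw [pairHkSq] at h2
  exact ⟨abs_le_of_sq_le_sq (by linarith [hφ.sq_le_HkSq hj ξ, nonneg ψ]) hδ0,
    abs_le_of_sq_le_sq (by linarith [hψ.sq_le_HkSq hj ξ, nonneg φ]) hδ0⟩

/-- Interpolation of the intermediate norms between the first and fourth derivatives. -/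
lemma L2sq_intermediate_le (h : SqIntegrableDerivs φ) {ε : ℝ} (hε : 0 < ε) :
    L2sq (iteratedDeriv 2 φ) + L2sq (iteratedDeriv 3 φ)
      ≤ 3 * ε * L2sq (iteratedDeriv 4 φ) + (1 / ε ^ 2 + 1) * L2sq (iteratedDeriv 1 φ) := by
  have i3 := h.L2sq_succ_le (j := 2) le_rfl hε
  have i2 := h.L2sq_succ_le (j := 1) (by norm_num) (ε := 2 * ε) (by positivity)
  have i2' := h.L2sq_succ_le (j := 1) (by norm_num) (ε := 1 / 2) (by norm_num)
  norm_num only at i3 i2 i2'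
  have n1 := L2sq_nonneg (iteratedDeriv 1 φ)
  generalize L2sq (iteratedDeriv 1 φ) = X1 at *
  generalize L2sq (iteratedDeriv 2 φ) = X2 at *
  generalize L2sq (iteratedDeriv 3 φ) = X3 at *
  generalize L2sq (iteratedDeriv 4 φ) = X4 at *
  have m : 1 / (4 * ε) * X2 ≤ 1 / (4 * ε) * (2 * ε * X3 + 1 / (4 * (2 * ε)) * X1) := by gcongr
  have e : 1 / (4 * ε) * (2 * ε * X3 + 1 / (4 * (2 * ε)) * X1)
      = 1 / 2 * X3 + 1 / 32 * (1 / ε ^ 2 * X1) := by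
    field_simp
    ring
  have n5 : 0 ≤ 1 / ε ^ 2 * X1 := by positivity
  linarith

lemma L2sq_two_le (h : SqIntegrableDerivs φ) :
    L2sq (iteratedDeriv 2 φ)
      ≤ 2 / 3 * L2sq (iteratedDeriv 3 φ) + 1 / 3 * L2sq (iteratedDeriv 0 φ) := by
  have i2 := h.L2sq_succ_le (j := 1) (by norm_num) (ε := 1 / 2) (by norm_num)
  have i1 := h.L2sq_succ_le (j := 0) (by norm_num) (ε := 1 / 2) (by norm_num)
  norm_num only at i2 i1
  linarith

end SqIntegrableDerivs

/-- The energy density as a function of the weight and the derivatives of the solution. -/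
def energyTerm (κ Λ a x₀ x₃ y₀ y₂ y₃ : ℝ) : ℝ :=
  Λ / 2 * (x₀ ^ 2 + a * y₀ ^ 2) + 1 / 2 * (x₃ ^ 2 + a * y₃ ^ 2) + κ * (y₂ * x₃)

lemma energyTerm_ge {κ Λ a c x₀ x₃ y₀ y₂ y₃ : ℝ} (hκ : 0 < κ) (hκ1 : κ ≤ 1 / 2)
    (hκc : κ ≤ c / 2) (hΛ : 1 ≤ Λ) (ha : c ≤ a) :
    1 / 4 * x₃ ^ 2 + c / 2 * y₃ ^ 2 + c / 2 * y₀ ^ 2 - c / 4 * y₂ ^ 2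
      ≤ energyTerm κ Λ a x₀ x₃ y₀ y₂ y₃ := by
  unfold energyTerm
  have c0 : 0 < c := by linarith
  have h1 : c * y₃ ^ 2 ≤ a * y₃ ^ 2 := by gcongr
  have h2 : 1 * (0 + c * y₀ ^ 2) ≤ Λ * (x₀ ^ 2 + a * y₀ ^ 2) := by gcongr; positivity
  have h3 : 0 ≤ κ * (y₂ + x₃) ^ 2 := by positivity
  have h4 : κ * x₃ ^ 2 ≤ 1 / 2 * x₃ ^ 2 := by gcongr
  have h5 : κ * y₂ ^ 2 ≤ c / 2 * y₂ ^ 2 := by gcongr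
  nlinarith

lemma abs_energyTerm_le {κ Λ a C x₀ x₃ y₀ y₂ y₃ : ℝ} (hκ : 0 < κ) (hκ1 : κ ≤ 1 / 2)
    (hΛ : 1 ≤ Λ) (hC : 1 ≤ C) (ha0 : 0 < a) (ha : a ≤ C) :
    |energyTerm κ Λ a x₀ x₃ y₀ y₂ y₃|
      ≤ Λ * C * (x₀ ^ 2 + y₀ ^ 2 + x₃ ^ 2 + y₂ ^ 2 + y₃ ^ 2) := by
  have hLC : 1 ≤ Λ * C := by nlinarith
  have h1 : |κ * (y₂ * x₃)| ≤ 1 / 4 * (y₂ ^ 2 + x₃ ^ 2) := by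
    rw [abs_mul, abs_of_pos hκ, abs_mul, ← sq_abs y₂, ← sq_abs x₃]
    have := mul_nonneg (abs_nonneg y₂) (abs_nonneg x₃)
    nlinarith [sq_nonneg (|y₂| - |x₃|)]
  have h2 : a * y₃ ^ 2 ≤ Λ * C * y₃ ^ 2 := by
    gcongr
    nlinarith
  have h3 : Λ * (x₀ ^ 2 + a * y₀ ^ 2) ≤ Λ * (C * x₀ ^ 2 + C * y₀ ^ 2) := by
    gcongr
    nlinarith [sq_nonneg x₀]
  have h4 : 0 ≤ Λ * (x₀ ^ 2 + a * y₀ ^ 2) := by positivity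
  have h5 : 0 ≤ a * y₃ ^ 2 := by positivity
  have h6 : 1 * x₃ ^ 2 ≤ Λ * C * x₃ ^ 2 := by gcongr
  have h7 : 1 * y₂ ^ 2 ≤ Λ * C * y₂ ^ 2 := by gcongr
  have h8 := sq_nonneg x₃
  have h9 := sq_nonneg y₂
  obtain ⟨l, u⟩ := abs_le.1 h1
  unfold energyTerm
  rw [abs_le]
  constructor <;> nlinarith

/-- The energy density of a pair at a fixed time. -/
def energyDensity (p tv : ℝ → ℝ) (κ Λ : ℝ) (φ ψ : ℝ → ℝ) (ξ : ℝ) : ℝ :=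
  energyTerm κ Λ (profileWeight p tv ξ) (iteratedDeriv 0 φ ξ) (iteratedDeriv 3 φ ξ)
    (iteratedDeriv 0 ψ ξ) (iteratedDeriv 2 ψ ξ) (iteratedDeriv 3 ψ ξ)

section

variable {p g tv φ ψ : ℝ → ℝ} {s vp C c κ Λ : ℝ}

lemma integrable_energyDensity (hb : CoefficientBounds p g tv s vp C c)
    (hcont : Continuous (profileWeight p tv)) (hφ : SqIntegrableDerivs φ)
    (hψ : SqIntegrableDerivs ψ) (hκ : 0 < κ) (hκ1 : κ ≤ 1 / 2) (hΛ : 1 ≤ Λ) :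
    Integrable (energyDensity p tv κ Λ φ ψ) := by
  have c0 := hφ.continuous (j := 0) (by norm_num)
  have c3 := hφ.continuous (j := 3) (by norm_num)
  have d0 := hψ.continuous (j := 0) (by norm_num)
  have d2 := hψ.continuous (j := 2) (by norm_num)
  have d3 := hψ.continuous (j := 3) (by norm_num)
  refine (((((hφ.sq 0 (by norm_num)).add (hψ.sq 0 (by norm_num))).add
    (hφ.sq 3 (by norm_num))).add (hψ.sq 2 (by norm_num))).add
    (hψ.sq 3 (by norm_num))).const_mul (Λ * C) |>.mono' ?_ (Eventually.of_forall fun ξ => ?_)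
  · refine Continuous.aestronglyMeasurable ?_
    unfold energyDensity energyTerm
    fun_prop
  · obtain ⟨w1, w2, -⟩ := hb.weight ξ
    exact abs_energyTerm_le hκ hκ1 hΛ hb.one_le (hb.pos.trans_le w1) w2

lemma integral_energyDensity_le (hb : CoefficientBounds p g tv s vp C c)
    (hcont : Continuous (profileWeight p tv)) (hφ : SqIntegrableDerivs φ)
    (hψ : SqIntegrableDerivs ψ) (hκ : 0 < κ) (hκ1 : κ ≤ 1 / 2) (hΛ : 1 ≤ Λ) :
    ∫ ξ, energyDensity p tv κ Λ φ ψ ξ ≤ Λ * C * pairHkSq 3 φ ψ := by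
  have x0 := hφ.sq 0 (by norm_num)
  have x3 := hφ.sq 3 (by norm_num)
  have y0 := hψ.sq 0 (by norm_num)
  have y2 := hψ.sq 2 (by norm_num)
  have y3 := hψ.sq 3 (by norm_num)
  have n1 := L2sq_nonneg (iteratedDeriv 1 φ)
  have n2 := L2sq_nonneg (iteratedDeriv 2 φ)
  have m1 := L2sq_nonneg (iteratedDeriv 1 ψ)
  have hLC : 0 ≤ Λ * C := mul_nonneg (by linarith) (by linarith [hb.one_le])
  calc ∫ ξ, energyDensity p tv κ Λ φ ψ ξ
      ≤ ∫ ξ, Λ * C * (iteratedDeriv 0 φ ξ ^ 2 + iteratedDeriv 0 ψ ξ ^ 2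
          + iteratedDeriv 3 φ ξ ^ 2 + iteratedDeriv 2 ψ ξ ^ 2 + iteratedDeriv 3 ψ ξ ^ 2) := by
        refine integral_mono (integrable_energyDensity hb hcont hφ hψ hκ hκ1 hΛ)
          (((((x0.add y0).add x3).add y2).add y3).const_mul _) fun ξ => ?_
        obtain ⟨w1, w2, -⟩ := hb.weight ξ
        exact (le_abs_self _).trans
          (abs_energyTerm_le hκ hκ1 hΛ hb.one_le (hb.pos.trans_le w1) w2)
    _ = Λ * C * (L2sq (iteratedDeriv 0 φ) + L2sq (iteratedDeriv 0 ψ)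
          + L2sq (iteratedDeriv 3 φ) + L2sq (iteratedDeriv 2 ψ) + L2sq (iteratedDeriv 3 ψ)) := by
        rw [integral_const_mul, integral_add (by fun_prop) y3, integral_add (by fun_prop) y2,
          integral_add (by fun_prop) x3, integral_add x0 y0]
        rfl
    _ ≤ _ := by
        rw [pairHkSq, HkSq_three, HkSq_three]
        refine mul_le_mul_of_nonneg_left ?_ hLC
        linarith

lemma le_integral_energyDensity (hb : CoefficientBounds p g tv s vp C c)
    (hcont : Continuous (profileWeight p tv)) (hφ : SqIntegrableDerivs φ)
    (hψ : SqIntegrableDerivs ψ) (hκ : 0 < κ) (hκ1 : κ ≤ 1 / 2) (hκc : κ ≤ c / 2)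
    (hΛ : 1 ≤ Λ) :
    1 / 4 * L2sq (iteratedDeriv 3 φ) + c / 4 * L2sq (iteratedDeriv 3 ψ)
      ≤ ∫ ξ, energyDensity p tv κ Λ φ ψ ξ := by
  have x3 := (hφ.sq 3 (by norm_num)).const_mul (1 / 4)
  have y0 := (hψ.sq 0 (by norm_num)).const_mul (c / 2)
  have y2 := (hψ.sq 2 (by norm_num)).const_mul (c / 4)
  have y3 := (hψ.sq 3 (by norm_num)).const_mul (c / 2)
  have m0 := L2sq_nonneg (iteratedDeriv 0 ψ)
  have m3 := L2sq_nonneg (iteratedDeriv 3 ψ)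
  have hc := hb.pos
  calc 1 / 4 * L2sq (iteratedDeriv 3 φ) + c / 4 * L2sq (iteratedDeriv 3 ψ)
      ≤ 1 / 4 * L2sq (iteratedDeriv 3 φ) + c / 2 * L2sq (iteratedDeriv 3 ψ)
        + c / 2 * L2sq (iteratedDeriv 0 ψ) - c / 4 * L2sq (iteratedDeriv 2 ψ) := by
        have := mul_le_mul_of_nonneg_left hψ.L2sq_two_le (show 0 ≤ c / 4 by positivity)
        have q1 := mul_nonneg hc.le m0
        have q2 := mul_nonneg hc.le m3
        nlinarith
    _ = ∫ ξ, (1 / 4 * iteratedDeriv 3 φ ξ ^ 2 + c / 2 * iteratedDeriv 3 ψ ξ ^ 2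
          + c / 2 * iteratedDeriv 0 ψ ξ ^ 2 - c / 4 * iteratedDeriv 2 ψ ξ ^ 2) := by
        rw [integral_sub (by fun_prop) y2, integral_add (by fun_prop) y0, integral_add x3 y3]
        simp only [integral_const_mul]
        rfl
    _ ≤ _ := by
        refine integral_mono (((x3.add y3).add y0).sub y2)
          (integrable_energyDensity hb hcont hφ hψ hκ hκ1 hΛ) fun ξ => ?_
        exact energyTerm_ge hκ hκ1 hκc hΛ (hb.weight ξ).1

end

lemma continuous_iteratedDeriv_comp {F v : ℝ → ℝ} (hF : ContDiffOn ℝ (⊤ : ℕ∞) F (Ioi 0))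
    (hv : Continuous v) (hpos : ∀ ξ, 0 < v ξ) (k : ℕ) :
    Continuous fun ξ => iteratedDeriv k F (v ξ) :=
  (contDiffOn_iteratedDeriv hF k).continuousOn.comp_continuous hv hpos

lemma continuous_chainDeriv₂ {F : ℝ → ℝ} (hF : ContDiffOn ℝ (⊤ : ℕ∞) F (Ioi 0))
    {v : ℝ → ℕ → ℝ} (hv : ∀ k ≤ 3, Continuous fun ξ => v ξ k) (hpos : ∀ ξ, 0 < v ξ 0) :
    Continuous fun ξ => chainDeriv₂ F (v ξ) := by
  have c1 := continuous_iteratedDeriv_comp hF (hv 0 (by norm_num)) hpos 1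
  have c2 := continuous_iteratedDeriv_comp hF (hv 0 (by norm_num)) hpos 2
  have v1 := hv 1 (by norm_num)
  have v2 := hv 2 (by norm_num)
  unfold chainDeriv₂
  fun_prop

lemma continuous_chainDeriv₃ {F : ℝ → ℝ} (hF : ContDiffOn ℝ (⊤ : ℕ∞) F (Ioi 0))
    {v : ℝ → ℕ → ℝ} (hv : ∀ k ≤ 3, Continuous fun ξ => v ξ k) (hpos : ∀ ξ, 0 < v ξ 0) :
    Continuous fun ξ => chainDeriv₃ F (v ξ) := by
  have c1 := continuous_iteratedDeriv_comp hF (hv 0 (by norm_num)) hpos 1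
  have c2 := continuous_iteratedDeriv_comp hF (hv 0 (by norm_num)) hpos 2
  have c3 := continuous_iteratedDeriv_comp hF (hv 0 (by norm_num)) hpos 3
  have v1 := hv 1 (by norm_num)
  have v2 := hv 2 (by norm_num)
  have v3 := hv 3 (by norm_num)
  unfold chainDeriv₃
  fun_prop

lemma continuous_bulkTerm {s κ Λ : ℝ} {a a' gv pv Rg Rp Qp Dg pr x₁ x₃ x₄ y₀ y₃ : ℝ → ℝ}
    (h₁ : Continuous a) (h₂ : Continuous a') (h₃ : Continuous gv) (h₄ : Continuous pv)
    (h₅ : Continuous Rg) (h₆ : Continuous Rp) (h₇ : Continuous Qp) (h₈ : Continuous Dg)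
    (h₉ : Continuous pr) (k₁ : Continuous x₁) (k₃ : Continuous x₃) (k₄ : Continuous x₄)
    (l₀ : Continuous y₀) (l₃ : Continuous y₃) :
    Continuous fun ξ => bulkTerm s κ Λ (a ξ) (a' ξ) (gv ξ) (pv ξ) (Rg ξ) (Rp ξ) (Qp ξ) (Dg ξ)
      (pr ξ) (x₁ ξ) (x₃ ξ) (x₄ ξ) (y₀ ξ) (y₃ ξ) := by
  unfold bulkTerm
  fun_prop

/-- The non-divergence part of the energy balance at a fixed time. -/
def bulkDensity (p g tv : ℝ → ℝ) (s κ Λ : ℝ) (φ ψ : ℝ → ℝ) (ξ : ℝ) : ℝ :=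
  bulkTerm s κ Λ (profileWeight p tv ξ) (profileWeight' p tv ξ)
    (iteratedDeriv 1 g (totalDeriv tv φ ξ 0)) (iteratedDeriv 1 p (totalDeriv tv φ ξ 0))
    (chainDeriv₃ g (totalDeriv tv φ ξ) - chainDeriv₃ g (fun k => iteratedDeriv k tv ξ)
      - iteratedDeriv 1 g (totalDeriv tv φ ξ 0) * iteratedDeriv 4 φ ξ)
    (chainDeriv₃ p (totalDeriv tv φ ξ) - chainDeriv₃ p (fun k => iteratedDeriv k tv ξ)
      - iteratedDeriv 1 p (totalDeriv tv φ ξ 0) * iteratedDeriv 4 φ ξ)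
    (chainDeriv₂ p (totalDeriv tv φ ξ) - chainDeriv₂ p (fun k => iteratedDeriv k tv ξ))
    (g (totalDeriv tv φ ξ 0) - g (tv ξ))
    (p (totalDeriv tv φ ξ 0) - p (tv ξ) - iteratedDeriv 1 p (tv ξ) * iteratedDeriv 1 φ ξ)
    (iteratedDeriv 1 φ ξ) (iteratedDeriv 3 φ ξ) (iteratedDeriv 4 φ ξ)
    (iteratedDeriv 0 ψ ξ) (iteratedDeriv 3 ψ ξ)

/-- The sum of the squares of all derivatives up to order four. -/
def sqSum (φ ψ : ℝ → ℝ) (ξ : ℝ) : ℝ :=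
  ∑ k ∈ Finset.range 5, (iteratedDeriv k φ ξ ^ 2 + iteratedDeriv k ψ ξ ^ 2)

lemma sqSum_nonneg (φ ψ : ℝ → ℝ) (ξ : ℝ) : 0 ≤ sqSum φ ψ ξ :=
  Finset.sum_nonneg fun _ _ => by positivity

lemma abs_le_sqrt_sqSum (φ ψ : ℝ → ℝ) (ξ : ℝ) {k : ℕ} (hk : k ≤ 4) :
    |iteratedDeriv k φ ξ| ≤ √(sqSum φ ψ ξ) ∧ |iteratedDeriv k ψ ξ| ≤ √(sqSum φ ψ ξ) := by
  have := Finset.single_le_sum (f := fun k => iteratedDeriv k φ ξ ^ 2 + iteratedDeriv k ψ ξ ^ 2)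
    (fun _ _ => by positivity) (Finset.mem_range.2 (by omega : k < 5))
  exact ⟨Real.abs_le_sqrt ((le_add_of_nonneg_right (sq_nonneg _)).trans this),
    Real.abs_le_sqrt ((le_add_of_nonneg_left (sq_nonneg _)).trans this)⟩

lemma integrable_sqSum {φ ψ : ℝ → ℝ} (hφ : SqIntegrableDerivs φ) (hψ : SqIntegrableDerivs ψ) :
    Integrable (sqSum φ ψ) :=
  integrable_finsetSum _ fun k hk => by
    rw [Finset.mem_range] at hk
    exact (hφ.sq k (by omega)).add (hψ.sq k (by omega))

lemma integral_sqSum {φ ψ : ℝ → ℝ} (hφ : SqIntegrableDerivs φ) (hψ : SqIntegrableDerivs ψ) :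
    ∫ ξ, sqSum φ ψ ξ
      = ∑ k ∈ Finset.range 5, (L2sq (iteratedDeriv k φ) + L2sq (iteratedDeriv k ψ)) := by
  have h : ∀ k ∈ Finset.range 5, k ≤ 4 := fun k hk => by
    rw [Finset.mem_range] at hk
    omega
  have hi : ∀ k ∈ Finset.range 5,
      Integrable fun ξ => iteratedDeriv k φ ξ ^ 2 + iteratedDeriv k ψ ξ ^ 2 :=
    fun k hk => (hφ.sq k (h k hk)).add (hψ.sq k (h k hk))
  unfold sqSum
  rw [integral_finsetSum _ hi]
  exact Finset.sum_congr rfl fun k hk => integral_add (hφ.sq k (h k hk)) (hψ.sq k (h k hk))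

/-- The admissible choices of the parameters in the energy estimate. -/
structure Admissible (vp C c κ Λ δ : ℝ) : Prop where
  κ_pos : 0 < κ
  κ_le_half : κ ≤ 1 / 2
  κ_le : κ ≤ c / 2
  κ_small : 16 * C ^ 2 * κ ≤ c
  one_le_Λ : 1 ≤ Λ
  δ_le : δ ≤ κ
  δ_le' : δ ≤ vp / 2
  δ_small : 2 * C * δ ≤ c

section

variable {p g tv φ ψ : ℝ → ℝ} {s vp C c κ Λ δ : ℝ}

lemma bulkDensity_le (hb : CoefficientBounds p g tv s vp C c) (ha : Admissible vp C c κ Λ δ)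
    {ξ : ℝ} (h0 : |iteratedDeriv 0 ψ ξ| ≤ δ) (h1 : |iteratedDeriv 1 φ ξ| ≤ δ)
    (h2 : |iteratedDeriv 2 φ ξ| ≤ δ) :
    bulkDensity p g tv s κ Λ φ ψ ξ
      ≤ -(c / 2) * iteratedDeriv 4 φ ξ ^ 2 - κ / 2 * iteratedDeriv 3 ψ ξ ^ 2
        + 3 * (8 * C ^ 2 / c + 16 * C ^ 4 / κ + C)
          * (iteratedDeriv 1 φ ξ ^ 2 + iteratedDeriv 2 φ ξ ^ 2 + iteratedDeriv 3 φ ξ ^ 2)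
        - Λ * (c / 2) * iteratedDeriv 1 φ ξ ^ 2 := by
  obtain ⟨w1, w2, w3, -⟩ := hb.weight ξ
  obtain ⟨-, n2, n3, -, n5, n6, n7, n8, n9, -, n11⟩ := hb.nonlinear ξ
    (fun k => iteratedDeriv k tv ξ) (fun k => iteratedDeriv (k + 1) φ ξ) (fun k => rfl)
    (h1.trans ha.δ_le') (h2.trans (by linarith [ha.δ_le, ha.κ_le_half]))
  have w0 : 0 < profileWeight p tv ξ := hb.pos.trans_le w1
  exact bulkTerm_le hb.one_le hb.pos ha.κ_pos (by linarith [ha.κ_le_half]) ha.κ_small ha.δ_le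
    ha.δ_small (by linarith [ha.one_le_Λ]) hb.abs_speed_le n2 n3 n5 n6 n7
    (by rwa [abs_of_pos w0]) w3 n8 (by simpa [totalDeriv] using n9)
    (by simpa [totalDeriv] using n11) h1 h0

lemma abs_bulkDensity_le (hb : CoefficientBounds p g tv s vp C c) (ha : Admissible vp C c κ Λ δ)
    {ξ : ℝ} (h1 : |iteratedDeriv 1 φ ξ| ≤ δ) (h2 : |iteratedDeriv 2 φ ξ| ≤ δ) :
    |bulkDensity p g tv s κ Λ φ ψ ξ| ≤ (30 + 3 * Λ) * C ^ 2 * sqSum φ ψ ξ := by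
  obtain ⟨w1, w2, -, w4⟩ := hb.weight ξ
  have δ1 : δ ≤ 1 := by linarith [ha.δ_le, ha.κ_le_half]
  obtain ⟨-, -, n3, n4, n5, n6, n7, -, -, n10, n11⟩ := hb.nonlinear ξ
    (fun k => iteratedDeriv k tv ξ) (fun k => iteratedDeriv (k + 1) φ ξ) (fun k => rfl)
    (h1.trans ha.δ_le') (h2.trans δ1)
  have w0 : 0 < profileWeight p tv ξ := hb.pos.trans_le w1
  have b := fun k hk => abs_le_sqrt_sqSum φ ψ ξ (k := k) hk
  rw [← Real.sq_sqrt (sqSum_nonneg φ ψ ξ)]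
  exact abs_bulkTerm_le hb.one_le ha.κ_pos (by linarith [ha.κ_le_half])
    (by linarith [ha.one_le_Λ]) (Real.sqrt_nonneg _) hb.abs_speed_le n3 n4 n5 n6 n7
    (by rwa [abs_of_pos w0]) w4 (by simpa [totalDeriv] using n10)
    (by simpa [totalDeriv] using n11) (h1.trans δ1)
    (b 1 (by norm_num)).1 (b 2 (by norm_num)).1 (b 3 (by norm_num)).1 (b 4 le_rfl).1
    (b 0 (by norm_num)).2 (b 3 (by norm_num)).2

lemma continuous_bulkDensity (hp : ContDiffOn ℝ (⊤ : ℕ∞) p (Ioi 0))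
    (hg : ContDiffOn ℝ (⊤ : ℕ∞) g (Ioi 0)) (htv : ContDiff ℝ (⊤ : ℕ∞) tv)
    (htv_pos : ∀ ξ, 0 < tv ξ) (hw : Continuous (profileWeight p tv))
    (hw' : Continuous (profileWeight' p tv)) (hφ : SqIntegrableDerivs φ)
    (hψ : SqIntegrableDerivs ψ) (hpos : ∀ ξ, 0 < totalDeriv tv φ ξ 0) :
    Continuous (bulkDensity p g tv s κ Λ φ ψ) := by
  have ct : ∀ k, Continuous (iteratedDeriv k tv) := fun k =>
    (contDiff_infty.1 htv k).continuous_iteratedDeriv k le_rfl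
  have cv : ∀ k ≤ 3, Continuous fun ξ => totalDeriv tv φ ξ k := fun k hk =>
    (ct k).add (hφ.continuous (by omega))
  have ct0 : Continuous tv := htv.continuous
  have c1 := hφ.continuous (j := 1) (by norm_num)
  have c3 := hφ.continuous (j := 3) (by norm_num)
  have c4 := hφ.continuous (j := 4) le_rfl
  have d0 := hψ.continuous (j := 0) (by norm_num)
  have d3 := hψ.continuous (j := 3) (by norm_num)
  have e1 := continuous_iteratedDeriv_comp hg (cv 0 (by norm_num)) hpos 1
  have e2 := continuous_iteratedDeriv_comp hp (cv 0 (by norm_num)) hpos 1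
  have e3 := continuous_iteratedDeriv_comp hp ct0 htv_pos 1
  have f1 : Continuous fun ξ => g (totalDeriv tv φ ξ 0) := by
    simpa using continuous_iteratedDeriv_comp hg (cv 0 (by norm_num)) hpos 0
  have f2 : Continuous fun ξ => p (totalDeriv tv φ ξ 0) := by
    simpa using continuous_iteratedDeriv_comp hp (cv 0 (by norm_num)) hpos 0
  have f3 : Continuous fun ξ => g (tv ξ) := by
    simpa using continuous_iteratedDeriv_comp hg ct0 htv_pos 0
  have f4 : Continuous fun ξ => p (tv ξ) := by
    simpa using continuous_iteratedDeriv_comp hp ct0 htv_pos 0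
  have k1 := continuous_chainDeriv₃ hg cv hpos
  have k2 := continuous_chainDeriv₃ hp cv hpos
  have k3 := continuous_chainDeriv₂ hp cv hpos
  have k4 := continuous_chainDeriv₃ hg (v := fun ξ k => iteratedDeriv k tv ξ)
    (fun k _ => ct k) (by simpa using htv_pos)
  have k5 := continuous_chainDeriv₃ hp (v := fun ξ k => iteratedDeriv k tv ξ)
    (fun k _ => ct k) (by simpa using htv_pos)
  have k6 := continuous_chainDeriv₂ hp (v := fun ξ k => iteratedDeriv k tv ξ)
    (fun k _ => ct k) (by simpa using htv_pos)
  exact continuous_bulkTerm hw hw' e1 e2 ((k1.sub k4).sub (e1.mul c4))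
    ((k2.sub k5).sub (e2.mul c4)) (k3.sub k6) (f1.sub f3) ((f2.sub f4).sub (e3.mul c1))
    c1 c3 c4 d0 d3

lemma integral_bulkDensity_le (hb : CoefficientBounds p g tv s vp C c)
    (ha : Admissible vp C c κ Λ δ) {ε : ℝ} (hε : 0 < ε)
    (hεc : 3 * (8 * C ^ 2 / c + 16 * C ^ 4 / κ + C) * (3 * ε) ≤ c / 4)
    (hΛ : 3 * (8 * C ^ 2 / c + 16 * C ^ 4 / κ + C) * (1 / ε ^ 2 + 2) ≤ Λ * (c / 2))
    (hcont : Continuous (bulkDensity p g tv s κ Λ φ ψ)) (hφ : SqIntegrableDerivs φ)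
    (hψ : SqIntegrableDerivs ψ) (hδ : √(pairHkSq 3 φ ψ) ≤ δ) :
    ∫ ξ, bulkDensity p g tv s κ Λ φ ψ ξ
      ≤ -(c / 4 * L2sq (iteratedDeriv 4 φ) + κ / 2 * L2sq (iteratedDeriv 3 ψ)) := by
  have small := fun j hj ξ => hφ.abs_le_of_small hψ hδ (j := j) hj ξ
  have x1 := hφ.sq 1 (by norm_num)
  have x2 := hφ.sq 2 (by norm_num)
  have x3 := hφ.sq 3 (by norm_num)
  have x4 := hφ.sq 4 le_rfl
  have y3 := hψ.sq 3 (by norm_num)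
  have hC : 0 < C := by linarith [hb.one_le]
  have hc := hb.pos
  have hκ := ha.κ_pos
  set K := 3 * (8 * C ^ 2 / c + 16 * C ^ 4 / κ + C) with hK
  have K0 : 0 < K := by positivity
  have hi : Integrable (bulkDensity p g tv s κ Λ φ ψ) :=
    ((integrable_sqSum hφ hψ).const_mul _).mono' hcont.aestronglyMeasurable
      (Eventually.of_forall fun ξ => abs_bulkDensity_le hb ha (small 1 (by norm_num) ξ).1
        (small 2 le_rfl ξ).1)
  have x123 : Integrable fun ξ => K * (iteratedDeriv 1 φ ξ ^ 2 + iteratedDeriv 2 φ ξ ^ 2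
      + iteratedDeriv 3 φ ξ ^ 2) := ((x1.add x2).add x3).const_mul K
  calc ∫ ξ, bulkDensity p g tv s κ Λ φ ψ ξ
      ≤ ∫ ξ, (-(c / 2) * iteratedDeriv 4 φ ξ ^ 2 - κ / 2 * iteratedDeriv 3 ψ ξ ^ 2
        + K * (iteratedDeriv 1 φ ξ ^ 2 + iteratedDeriv 2 φ ξ ^ 2 + iteratedDeriv 3 φ ξ ^ 2)
        - Λ * (c / 2) * iteratedDeriv 1 φ ξ ^ 2) :=
        integral_mono hi ((((x4.const_mul _).sub (y3.const_mul _)).add x123).sub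
          (x1.const_mul _)) fun ξ =>
          bulkDensity_le hb ha (small 0 (by norm_num) ξ).2 (small 1 (by norm_num) ξ).1
            (small 2 le_rfl ξ).1
    _ = -(c / 2) * L2sq (iteratedDeriv 4 φ) - κ / 2 * L2sq (iteratedDeriv 3 ψ)
        + K * (L2sq (iteratedDeriv 1 φ) + L2sq (iteratedDeriv 2 φ) + L2sq (iteratedDeriv 3 φ))
        - Λ * (c / 2) * L2sq (iteratedDeriv 1 φ) := by
        rw [integral_sub (by fun_prop) (x1.const_mul _),
          integral_add (by fun_prop) x123,
          integral_sub (x4.const_mul _) (y3.const_mul _)]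
        simp only [integral_const_mul]
        rw [integral_add (by fun_prop) x3, integral_add x1 x2]
        rfl
    _ ≤ _ := by
        have i := mul_le_mul_of_nonneg_left (hφ.L2sq_intermediate_le hε) K0.le
        have j1 := mul_le_mul_of_nonneg_right hεc (L2sq_nonneg (iteratedDeriv 4 φ))
        have j2 := mul_le_mul_of_nonneg_right hΛ (L2sq_nonneg (iteratedDeriv 1 φ))
        clear_value K
        linarith

end

/-- The flux in the energy balance; `d` stands for `∂_t Φ_ξξ`. -/
def fluxTerm (s κ Λ a d Dg x₀ x₃ y₀ y₂ y₃ : ℝ) : ℝ :=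
  (x₃ + κ * y₂) * d + 1 / 2 * s * (a * y₃ ^ 2)
    + Λ * (1 / 2 * s * x₀ ^ 2 + x₀ * y₀ + 1 / 2 * s * (a * y₀ ^ 2) + x₀ * Dg)

/-- The spatial derivative of the flux. -/
def fluxDerivTerm (s κ Λ a a' d d' Dg Dg' x₀ x₁ x₃ x₄ y₀ y₁ y₂ y₃ y₄ : ℝ) : ℝ :=
  (x₄ + κ * y₃) * d + (x₃ + κ * y₂) * d' + 1 / 2 * s * (a' * y₃ ^ 2 + a * (2 * (y₃ * y₄)))
    + Λ * (1 / 2 * s * (2 * (x₀ * x₁)) + (x₁ * y₀ + x₀ * y₁)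
      + 1 / 2 * s * (a' * y₀ ^ 2 + a * (2 * (y₀ * y₁))) + (x₁ * Dg + x₀ * Dg'))

/-- The time derivative of the energy density, in terms of the time derivatives
`D k`, `E k` of the spatial derivatives of the solution. -/
def energyRateTerm (κ Λ a x₀ x₃ y₀ y₂ y₃ D₀ D₃ E₀ E₂ E₃ : ℝ) : ℝ :=
  Λ * (x₀ * D₀ + a * (y₀ * E₀)) + (x₃ * D₃ + a * (y₃ * E₃)) + κ * (E₂ * x₃ + y₂ * D₃)

lemma energyRateTerm_eq {s κ Λ a a' gv pv pw Rg Rp Qp Dg Dg' dp x₀ x₁ x₃ x₄ y₀ y₁ y₂ y₃ y₄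
    D₀ d d' E₀ E₂ E₃ : ℝ} (hD₀ : D₀ = s * x₁ + y₁ + Dg') (hE₀ : E₀ = s * y₁ - dp)
    (hd : d = s * x₃ + y₃ + gv * x₄ + Rg) (hE₂ : E₂ = s * y₃ - Qp)
    (hE₃ : E₃ = s * y₄ - (pv * x₄ + Rp)) (ha : a * pw = -1) :
    energyRateTerm κ Λ a x₀ x₃ y₀ y₂ y₃ D₀ d' E₀ E₂ E₃
      = bulkTerm s κ Λ a a' gv pv Rg Rp Qp Dg (dp - pw * x₁) x₁ x₃ x₄ y₀ y₃
        + fluxDerivTerm s κ Λ a a' d d' Dg Dg' x₀ x₁ x₃ x₄ y₀ y₁ y₂ y₃ y₄ := by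
  subst hD₀ hE₀ hd hE₂ hE₃
  simp only [energyRateTerm, bulkTerm, fluxDerivTerm]
  linear_combination (-Λ * y₀ * x₁) * ha

lemma hasDerivAt_energyTerm {κ Λ a x₀' x₃' y₀' y₂' y₃' τ : ℝ} {x₀ x₃ y₀ y₂ y₃ : ℝ → ℝ}
    (h₀ : HasDerivAt x₀ x₀' τ) (h₃ : HasDerivAt x₃ x₃' τ) (k₀ : HasDerivAt y₀ y₀' τ)
    (k₂ : HasDerivAt y₂ y₂' τ) (k₃ : HasDerivAt y₃ y₃' τ) :
    HasDerivAt (fun r => energyTerm κ Λ a (x₀ r) (x₃ r) (y₀ r) (y₂ r) (y₃ r))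
      (energyRateTerm κ Λ a (x₀ τ) (x₃ τ) (y₀ τ) (y₂ τ) (y₃ τ) x₀' x₃' y₀' y₂' y₃') τ := by
  refine (((((h₀.pow 2).add ((k₀.pow 2).const_mul a)).const_mul (Λ / 2)).add
    (((h₃.pow 2).add ((k₃.pow 2).const_mul a)).const_mul (1 / 2))).add
    ((k₂.mul h₃).const_mul κ)).congr_deriv ?_
  simp only [energyRateTerm]
  norm_num
  ring

lemma hasDerivAt_fluxTerm {s κ Λ ξ a' d' Dg' x₁ x₄ y₁ y₃ y₄ : ℝ} {a d Dg x₀ x₃ y₀ y₂ : ℝ → ℝ}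
    {z₃ : ℝ → ℝ} (ha : HasDerivAt a a' ξ) (hd : HasDerivAt d d' ξ) (hDg : HasDerivAt Dg Dg' ξ)
    (h₀ : HasDerivAt x₀ x₁ ξ) (h₃ : HasDerivAt x₃ x₄ ξ) (k₀ : HasDerivAt y₀ y₁ ξ)
    (k₂ : HasDerivAt y₂ y₃ ξ) (k₃ : HasDerivAt z₃ y₄ ξ) (hz : z₃ ξ = y₃) :
    HasDerivAt (fun x => fluxTerm s κ Λ (a x) (d x) (Dg x) (x₀ x) (x₃ x) (y₀ x) (y₂ x) (z₃ x))
      (fluxDerivTerm s κ Λ (a ξ) a' (d ξ) d' (Dg ξ) Dg' (x₀ ξ) x₁ (x₃ ξ) x₄ (y₀ ξ) y₁ (y₂ ξ)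
        y₃ y₄) ξ := by
  refine ((((h₃.add (k₂.const_mul κ)).mul hd).add ((ha.mul (k₃.pow 2)).const_mul
    (1 / 2 * s))).add (((((h₀.pow 2).const_mul (1 / 2 * s)).add (h₀.mul k₀)).add
    ((ha.mul (k₀.pow 2)).const_mul (1 / 2 * s))).add (h₀.mul hDg) |>.const_mul Λ)).congr_deriv ?_
  simp only [fluxDerivTerm, Pi.pow_apply, Pi.add_apply]
  rw [hz]
  norm_num
  ring

lemma abs_fluxTerm_le {C s κ Λ a d Dg gv Rg x₀ x₁ x₂ x₃ x₄ y₀ y₂ y₃ n : ℝ}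
    (hC : 1 ≤ C) (hκ : 0 < κ) (hκ1 : κ ≤ 1) (hΛ : 0 ≤ Λ) (hn : 0 ≤ n) (hs : |s| ≤ C)
    (hgC : |gv| ≤ C) (hRg : |Rg| ≤ C * (|x₁| + |x₂| + |x₃|)) (ha : |a| ≤ C)
    (hDg : |Dg| ≤ C * |x₁|) (hd : d = s * x₃ + y₃ + gv * x₄ + Rg)
    (h0 : |x₀| ≤ n) (h1 : |x₁| ≤ n) (h2 : |x₂| ≤ n) (h3 : |x₃| ≤ n) (h4 : |x₄| ≤ n)
    (h5 : |y₀| ≤ n) (h6 : |y₂| ≤ n) (h7 : |y₃| ≤ n) :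
    |fluxTerm s κ Λ a d Dg x₀ x₃ y₀ y₂ y₃| ≤ (30 + 3 * Λ) * C ^ 2 * n ^ 2 := by
  have hC0 : 0 ≤ C := by linarith
  have CC : C ≤ C ^ 2 := le_self_pow₀ hC (by norm_num)
  have C1 : 1 ≤ C ^ 2 := one_le_pow₀ hC
  have rg : |Rg| ≤ C * (3 * n) := hRg.trans (by gcongr; linarith)
  have bd : |d| ≤ C * n + n + C * n + C * (3 * n) := by
    rw [hd]
    refine (abs_add_le _ _).trans (add_le_add ((abs_add_le _ _).trans (add_le_add
        ((abs_add_le _ _).trans (add_le_add ?_ h7)) ?_)) rg)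
    · rw [abs_mul]
      gcongr
    · rw [abs_mul]
      gcongr
  have sq : ∀ z : ℝ, |z| ≤ n → |1 / 2 * s * (a * z ^ 2)| ≤ 1 / 2 * C * (C * n ^ 2) := by
    intro z hz
    rw [abs_mul, abs_mul, abs_mul, abs_pow, abs_of_pos (by norm_num : (0:ℝ) < 1 / 2)]
    gcongr
  have t1 : |(x₃ + κ * y₂) * d| ≤ (n + 1 * n) * (C * n + n + C * n + C * (3 * n)) := by
    rw [abs_mul]
    gcongr
    refine (abs_add_le _ _).trans (add_le_add h3 ?_)
    rw [abs_mul, abs_of_pos hκ]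
    gcongr
  have t2 : |1 / 2 * s * x₀ ^ 2| ≤ 1 / 2 * C * n ^ 2 := by
    rw [abs_mul, abs_mul, abs_pow, abs_of_pos (by norm_num : (0:ℝ) < 1 / 2)]
    gcongr
  have t3 : |x₀ * y₀| ≤ n * n := by
    rw [abs_mul]
    gcongr
  have t4 : |x₀ * Dg| ≤ n * (C * n) := by
    rw [abs_mul]
    gcongr
    exact hDg.trans (by gcongr)
  have t5 : |Λ * (1 / 2 * s * x₀ ^ 2 + x₀ * y₀ + 1 / 2 * s * (a * y₀ ^ 2) + x₀ * Dg)|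
      ≤ Λ * (1 / 2 * C * n ^ 2 + n * n + 1 / 2 * C * (C * n ^ 2) + n * (C * n)) := by
    rw [abs_mul, abs_of_nonneg hΛ]
    gcongr
    exact (abs_add_le _ _).trans (add_le_add ((abs_add_le _ _).trans (add_le_add
      ((abs_add_le _ _).trans (add_le_add t2 t3)) (sq _ h5))) t4)
  unfold fluxTerm
  refine ((abs_add_le _ _).trans (add_le_add ((abs_add_le _ _).trans
    (add_le_add t1 (sq _ h7))) t5)).trans ?_
  have n2 : 0 ≤ n ^ 2 := by positivity
  have u1 := mul_le_mul_of_nonneg_right CC n2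
  have u2 := mul_le_mul_of_nonneg_right C1 n2
  have u3 := mul_le_mul_of_nonneg_left u1 hΛ
  have u4 := mul_le_mul_of_nonneg_left u2 hΛ
  nlinarith

lemma continuousOn_energyRateTerm {κ Λ : ℝ} {S : Set (ℝ × ℝ)}
    {a x₀ x₃ y₀ y₂ y₃ D₀ D₃ E₀ E₂ E₃ : ℝ × ℝ → ℝ}
    (h : ContinuousOn a S) (h₀ : ContinuousOn x₀ S) (h₃ : ContinuousOn x₃ S)
    (k₀ : ContinuousOn y₀ S) (k₂ : ContinuousOn y₂ S) (k₃ : ContinuousOn y₃ S)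
    (l₀ : ContinuousOn D₀ S) (l₃ : ContinuousOn D₃ S) (m₀ : ContinuousOn E₀ S)
    (m₂ : ContinuousOn E₂ S) (m₃ : ContinuousOn E₃ S) :
    ContinuousOn (fun q => energyRateTerm κ Λ (a q) (x₀ q) (x₃ q) (y₀ q) (y₂ q) (y₃ q) (D₀ q)
      (D₃ q) (E₀ q) (E₂ q) (E₃ q)) S := by
  unfold energyRateTerm
  fun_prop

lemma hasDerivAt_profileWeight {p tv : ℝ → ℝ} (hp : ContDiffOn ℝ (⊤ : ℕ∞) p (Ioi 0))
    (htv : ContDiff ℝ (⊤ : ℕ∞) tv) (htv_pos : ∀ ξ, 0 < tv ξ)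
    (hpd : ∀ v > 0, iteratedDeriv 1 p v < 0) (ξ : ℝ) :
    HasDerivAt (profileWeight p tv) (profileWeight' p tv ξ) ξ := by
  have h0 : HasDerivAt tv (iteratedDeriv 1 tv ξ) ξ := by
    simpa using hasDerivAt_iteratedDeriv (contDiff_infty.1 htv 1) (j := 0) (by norm_num) ξ
  have h := ((hasDerivAt_iteratedDeriv_of_pos hp 1 (htv_pos ξ)).comp ξ h0).inv
    (hpd _ (htv_pos ξ)).ne |>.neg
  refine h.congr_deriv ?_
  simp [profileWeight', neg_div]

lemma continuous_profileWeight {p tv : ℝ → ℝ} (hp : ContDiffOn ℝ (⊤ : ℕ∞) p (Ioi 0))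
    (htv : ContDiff ℝ (⊤ : ℕ∞) tv) (htv_pos : ∀ ξ, 0 < tv ξ)
    (hpd : ∀ v > 0, iteratedDeriv 1 p v < 0) :
    Continuous (profileWeight p tv) ∧ Continuous (profileWeight' p tv) := by
  have c1 := continuous_iteratedDeriv_comp hp htv.continuous htv_pos 1
  have c2 := continuous_iteratedDeriv_comp hp htv.continuous htv_pos 2
  have c3 : Continuous (iteratedDeriv 1 tv) :=
    (contDiff_infty.1 htv 1).continuous_iteratedDeriv 1 le_rfl
  have ne : ∀ ξ, iteratedDeriv 1 p (tv ξ) ≠ 0 := fun ξ => (hpd _ (htv_pos ξ)).ne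
  exact ⟨(c1.inv₀ ne).neg, (c2.mul c3).div (c1.pow 2) fun ξ => pow_ne_zero 2 (ne ξ)⟩

section

variable {p g tv : ℝ → ℝ} {s vp C c κ Λ δ T : ℝ} {Φ Ψ : ℝ → ℝ → ℝ}

lemma profileWeight_mul (hb : CoefficientBounds p g tv s vp C c) (ξ : ℝ) :
    profileWeight p tv ξ * iteratedDeriv 1 p (tv ξ) = -1 := by
  have h := hb.pos.trans_le (hb.weight ξ).1
  have hne : iteratedDeriv 1 p (tv ξ) ≠ 0 := by
    intro h0
    simp [profileWeight, h0] at h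
  rw [profileWeight, neg_mul, inv_mul_cancel₀ hne]

lemma totalDeriv_pos (hb : CoefficientBounds p g tv s vp C c) (ha : Admissible vp C c κ Λ δ)
    {φ ψ : ℝ → ℝ} (hφ : SqIntegrableDerivs φ) (hψ : SqIntegrableDerivs ψ)
    (hδ : √(pairHkSq 3 φ ψ) ≤ δ) (ξ : ℝ) : 0 < totalDeriv tv φ ξ 0 := by
  have h1 := (hφ.abs_le_of_small hψ hδ (j := 1) (by norm_num) ξ).1
  have h2 := (hφ.abs_le_of_small hψ hδ (j := 2) le_rfl ξ).1
  exact (hb.nonlinear ξ (fun k => iteratedDeriv k tv ξ) (fun k => iteratedDeriv (k + 1) φ ξ)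
    (fun _ => rfl) (h1.trans ha.δ_le') (h2.trans (by linarith [ha.δ_le, ha.κ_le_half]))).1

namespace IsClassicalSolution

lemma sqIntegrableDerivs_left (sol : IsClassicalSolution p g tv s T Φ Ψ) {t : ℝ}
    (ht : t ∈ Icc 0 T) : SqIntegrableDerivs (Φ t) :=
  ⟨sol.regΦ t ht, fun j hj => sol.sqIntΦ j hj t ht⟩

lemma sqIntegrableDerivs_right (sol : IsClassicalSolution p g tv s T Φ Ψ) {t : ℝ}
    (ht : t ∈ Icc 0 T) : SqIntegrableDerivs (Ψ t) :=
  ⟨sol.regΨ t ht, fun j hj => sol.sqIntΨ j hj t ht⟩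

lemma exists_integral_sqSum_le (sol : IsClassicalSolution p g tv s T Φ Ψ) :
    ∃ M, ∀ t ∈ Icc (0:ℝ) T, ∫ ξ, sqSum (Φ t) (Ψ t) ξ ≤ M := by
  have hcont : ContinuousOn (fun t => ∑ k ∈ Finset.range 5,
      (L2sq (iteratedDeriv k (Φ t)) + L2sq (iteratedDeriv k (Ψ t)))) (Icc (0:ℝ) T) :=
    continuousOn_finsetSum _ fun k hk => by
      rw [Finset.mem_range] at hk
      exact (sol.l2ContΦ k (by omega)).add (sol.l2ContΨ k (by omega))
  obtain ⟨M, hM⟩ := isCompact_Icc.bddAbove_image hcont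
  refine ⟨M, fun t ht => ?_⟩
  rw [integral_sqSum (sol.sqIntegrableDerivs_left ht) (sol.sqIntegrableDerivs_right ht)]
  exact hM (mem_image_of_mem _ ht)

/-- The energy balance in divergence form. -/
lemma energyRateTerm_timeDeriv_eq (sol : IsClassicalSolution p g tv s T Φ Ψ) (hT : 0 < T)
    (hp : ContDiffOn ℝ (⊤ : ℕ∞) p (Ioi 0)) (hg : ContDiffOn ℝ (⊤ : ℕ∞) g (Ioi 0))
    (htv : ContDiff ℝ (⊤ : ℕ∞) tv) (htv_pos : ∀ ξ, 0 < tv ξ)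
    (hb : CoefficientBounds p g tv s vp C c) {t : ℝ} (ht : t ∈ Icc 0 T)
    (hpos : ∀ ξ, 0 < totalDeriv tv (Φ t) ξ 0) (ξ : ℝ) :
    energyRateTerm κ Λ (profileWeight p tv ξ) (iteratedDeriv 0 (Φ t) ξ)
        (iteratedDeriv 3 (Φ t) ξ) (iteratedDeriv 0 (Ψ t) ξ) (iteratedDeriv 2 (Ψ t) ξ)
        (iteratedDeriv 3 (Ψ t) ξ) (timeDeriv Φ 0 t ξ) (timeDeriv Φ 3 t ξ) (timeDeriv Ψ 0 t ξ)
        (timeDeriv Ψ 2 t ξ) (timeDeriv Ψ 3 t ξ)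
      = bulkDensity p g tv s κ Λ (Φ t) (Ψ t) ξ
        + fluxDerivTerm s κ Λ (profileWeight p tv ξ) (profileWeight' p tv ξ)
          (timeDeriv Φ 2 t ξ) (timeDeriv Φ 3 t ξ) (g (totalDeriv tv (Φ t) ξ 0) - g (tv ξ))
          (chainDeriv₁ g (totalDeriv tv (Φ t) ξ) - chainDeriv₁ g fun k => iteratedDeriv k tv ξ)
          (iteratedDeriv 0 (Φ t) ξ) (iteratedDeriv 1 (Φ t) ξ) (iteratedDeriv 3 (Φ t) ξ)
          (iteratedDeriv 4 (Φ t) ξ) (iteratedDeriv 0 (Ψ t) ξ) (iteratedDeriv 1 (Ψ t) ξ)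
          (iteratedDeriv 2 (Ψ t) ξ) (iteratedDeriv 3 (Ψ t) ξ) (iteratedDeriv 4 (Ψ t) ξ) := by
  obtain ⟨D0, E0, D2, E2, E3⟩ := sol.timeDeriv_eq hT hp hg htv htv_pos ht hpos ξ
  exact energyRateTerm_eq D0 E0 (D2.trans (by ring)) E2 (E3.trans (by ring))
    (profileWeight_mul hb ξ)

lemma hasDerivAt_flux (sol : IsClassicalSolution p g tv s T Φ Ψ) (hT : 0 < T)
    (hp : ContDiffOn ℝ (⊤ : ℕ∞) p (Ioi 0)) (hg : ContDiffOn ℝ (⊤ : ℕ∞) g (Ioi 0))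
    (htv : ContDiff ℝ (⊤ : ℕ∞) tv) (htv_pos : ∀ ξ, 0 < tv ξ)
    (hpd : ∀ v > 0, iteratedDeriv 1 p v < 0) {t : ℝ} (ht : t ∈ Icc 0 T)
    (hpos : ∀ ξ, 0 < totalDeriv tv (Φ t) ξ 0) (ξ : ℝ) :
    HasDerivAt (fun x => fluxTerm s κ Λ (profileWeight p tv x) (timeDeriv Φ 2 t x)
        (g (totalDeriv tv (Φ t) x 0) - g (tv x)) (iteratedDeriv 0 (Φ t) x)
        (iteratedDeriv 3 (Φ t) x) (iteratedDeriv 0 (Ψ t) x) (iteratedDeriv 2 (Ψ t) x)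
        (iteratedDeriv 3 (Ψ t) x))
      (fluxDerivTerm s κ Λ (profileWeight p tv ξ) (profileWeight' p tv ξ)
          (timeDeriv Φ 2 t ξ) (timeDeriv Φ 3 t ξ) (g (totalDeriv tv (Φ t) ξ 0) - g (tv ξ))
          (chainDeriv₁ g (totalDeriv tv (Φ t) ξ) - chainDeriv₁ g fun k => iteratedDeriv k tv ξ)
          (iteratedDeriv 0 (Φ t) ξ) (iteratedDeriv 1 (Φ t) ξ) (iteratedDeriv 3 (Φ t) ξ)
          (iteratedDeriv 4 (Φ t) ξ) (iteratedDeriv 0 (Ψ t) ξ) (iteratedDeriv 1 (Ψ t) ξ)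
          (iteratedDeriv 2 (Ψ t) ξ) (iteratedDeriv 3 (Ψ t) ξ) (iteratedDeriv 4 (Ψ t) ξ)) ξ := by
  have hΦ := sol.sqIntegrableDerivs_left ht
  have hΨ := sol.sqIntegrableDerivs_right ht
  have hw : ∀ k < 3, HasDerivAt (iteratedDeriv k tv) (iteratedDeriv (k + 1) tv ξ) ξ :=
    fun k hk => hasDerivAt_iteratedDeriv (contDiff_infty.1 htv 4) (by omega) ξ
  have hv : ∀ k < 3, HasDerivAt (fun x => totalDeriv tv (Φ t) x k)
      (totalDeriv tv (Φ t) ξ (k + 1)) ξ :=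
    fun k hk => (hw k hk).add (hΦ.hasDerivAt (by omega) ξ)
  have v1 : HasDerivAt (fun x => g (totalDeriv tv (Φ t) x 0))
      (chainDeriv₁ g (totalDeriv tv (Φ t) ξ)) ξ :=
    hasDerivAt_comp_chainDeriv₁ (w := fun k x => totalDeriv tv (Φ t) x k) hg (hpos ξ) hv
  have w1 : HasDerivAt (fun x => g (tv x)) (chainDeriv₁ g fun k => iteratedDeriv k tv ξ) ξ := by
    simpa using hasDerivAt_comp_chainDeriv₁ (w := fun k x => iteratedDeriv k tv x) hg
      (iteratedDeriv_zero (f := tv) ▸ htv_pos ξ) hw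
  exact hasDerivAt_fluxTerm (hasDerivAt_profileWeight hp htv htv_pos hpd ξ)
    (hasDerivAt_timeDeriv hT sol.regΦ sol.tdiffΦ sol.mixContΦ (by norm_num) ht ξ) (v1.sub w1)
    (hΦ.hasDerivAt (by norm_num) ξ) (hΦ.hasDerivAt (by norm_num) ξ)
    (hΨ.hasDerivAt (by norm_num) ξ) (hΨ.hasDerivAt (by norm_num) ξ)
    (hΨ.hasDerivAt (by norm_num) ξ) rfl

lemma abs_flux_le (sol : IsClassicalSolution p g tv s T Φ Ψ) (hT : 0 < T)
    (hp : ContDiffOn ℝ (⊤ : ℕ∞) p (Ioi 0)) (hg : ContDiffOn ℝ (⊤ : ℕ∞) g (Ioi 0))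
    (htv : ContDiff ℝ (⊤ : ℕ∞) tv) (htv_pos : ∀ ξ, 0 < tv ξ)
    (hb : CoefficientBounds p g tv s vp C c) (ha : Admissible vp C c κ Λ δ) {t : ℝ}
    (ht : t ∈ Icc 0 T) (hδ : √(pairHkSq 3 (Φ t) (Ψ t)) ≤ δ) (ξ : ℝ) :
    |fluxTerm s κ Λ (profileWeight p tv ξ) (timeDeriv Φ 2 t ξ)
        (g (totalDeriv tv (Φ t) ξ 0) - g (tv ξ)) (iteratedDeriv 0 (Φ t) ξ)
        (iteratedDeriv 3 (Φ t) ξ) (iteratedDeriv 0 (Ψ t) ξ) (iteratedDeriv 2 (Ψ t) ξ)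
        (iteratedDeriv 3 (Ψ t) ξ)| ≤ (30 + 3 * Λ) * C ^ 2 * sqSum (Φ t) (Ψ t) ξ := by
  have hΦ := sol.sqIntegrableDerivs_left ht
  have hΨ := sol.sqIntegrableDerivs_right ht
  have h1 := (hΦ.abs_le_of_small hΨ hδ (j := 1) (by norm_num) ξ).1
  have h2 := (hΦ.abs_le_of_small hΨ hδ (j := 2) le_rfl ξ).1
  obtain ⟨w1, w2, -⟩ := hb.weight ξ
  obtain ⟨-, -, n3, -, n5, -, -, -, -, n10, -⟩ := hb.nonlinear ξ
    (fun k => iteratedDeriv k tv ξ) (fun k => iteratedDeriv (k + 1) (Φ t) ξ) (fun _ => rfl)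
    (h1.trans ha.δ_le') (h2.trans (by linarith [ha.δ_le, ha.κ_le_half]))
  obtain ⟨-, -, D2, -⟩ := sol.timeDeriv_eq hT hp hg htv htv_pos ht
    (totalDeriv_pos hb ha hΦ hΨ hδ) ξ
  have D2' : timeDeriv Φ 2 t ξ = s * iteratedDeriv 3 (Φ t) ξ + iteratedDeriv 3 (Ψ t) ξ
      + iteratedDeriv 1 g (totalDeriv tv (Φ t) ξ 0) * iteratedDeriv 4 (Φ t) ξ
      + (chainDeriv₃ g (totalDeriv tv (Φ t) ξ) - chainDeriv₃ g (fun k => iteratedDeriv k tv ξ)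
        - iteratedDeriv 1 g (totalDeriv tv (Φ t) ξ 0) * iteratedDeriv 4 (Φ t) ξ) :=
    D2.trans (by ring)
  have b := fun k hk => abs_le_sqrt_sqSum (Φ t) (Ψ t) ξ (k := k) hk
  rw [← Real.sq_sqrt (sqSum_nonneg (Φ t) (Ψ t) ξ)]
  exact abs_fluxTerm_le hb.one_le ha.κ_pos (by linarith [ha.κ_le_half])
    (by linarith [ha.one_le_Λ]) (Real.sqrt_nonneg _) hb.abs_speed_le n3 n5
    (by rwa [abs_of_pos (hb.pos.trans_le w1)]) n10
    D2'
    (b 0 (by norm_num)).1 (b 1 (by norm_num)).1 (b 2 (by norm_num)).1 (b 3 (by norm_num)).1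
    (b 4 le_rfl).1 (b 0 (by norm_num)).2 (b 2 (by norm_num)).2 (b 3 (by norm_num)).2

lemma energyDensity_estimate (sol : IsClassicalSolution p g tv s T Φ Ψ) (hT : 0 < T)
    (hp : ContDiffOn ℝ (⊤ : ℕ∞) p (Ioi 0)) (hg : ContDiffOn ℝ (⊤ : ℕ∞) g (Ioi 0))
    (htv : ContDiff ℝ (⊤ : ℕ∞) tv) (htv_pos : ∀ ξ, 0 < tv ξ)
    (hpd : ∀ v > 0, iteratedDeriv 1 p v < 0)
    (hb : CoefficientBounds p g tv s vp C c) (ha : Admissible vp C c κ Λ δ) {ε : ℝ} (hε : 0 < ε)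
    (hεc : 3 * (8 * C ^ 2 / c + 16 * C ^ 4 / κ + C) * (3 * ε) ≤ c / 4)
    (hΛ : 3 * (8 * C ^ 2 / c + 16 * C ^ 4 / κ + C) * (1 / ε ^ 2 + 2) ≤ Λ * (c / 2))
    (hδ : ∀ t ∈ Icc (0:ℝ) T, √(pairHkSq 3 (Φ t) (Ψ t)) ≤ δ) :
    ∀ t ∈ Icc (0:ℝ) T, (∫ ξ, energyDensity p tv κ Λ (Φ t) (Ψ t) ξ)
        + (∫ τ in (0:ℝ)..t, (c / 4 * L2sq (iteratedDeriv 4 (Φ τ))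
          + κ / 2 * L2sq (iteratedDeriv 3 (Ψ τ))))
      ≤ ∫ ξ, energyDensity p tv κ Λ (Φ 0) (Ψ 0) ξ := by
  obtain ⟨cw, cw'⟩ := continuous_profileWeight hp htv htv_pos hpd
  obtain ⟨M, hM⟩ := sol.exists_integral_sqSum_le
  have hL : 0 ≤ (30 + 3 * Λ) * C ^ 2 := by nlinarith [ha.one_le_Λ, sq_nonneg C]
  have hpos : ∀ t ∈ Icc (0:ℝ) T, ∀ ξ, 0 < totalDeriv tv (Φ t) ξ 0 := fun t ht =>
    totalDeriv_pos hb ha (sol.sqIntegrableDerivs_left ht) (sol.sqIntegrableDerivs_right ht)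
      (hδ t ht)
  have balance := fun t ht => sol.energyRateTerm_timeDeriv_eq (κ := κ) (Λ := Λ) hT hp hg htv
    htv_pos hb (t := t) ht (hpos t ht)
  refine energy_inequality hT (H := fun t ξ => (30 + 3 * Λ) * C ^ 2 * sqSum (Φ t) (Ψ t) ξ)
    (A := fun t => bulkDensity p g tv s κ Λ (Φ t) (Ψ t)) (M := (30 + 3 * Λ) * C ^ 2 * M)
    (fun t ht ξ => ?_) ?_
    (fun t ht ξ => sol.hasDerivAt_flux (κ := κ) (Λ := Λ) hT hp hg htv htv_pos hpd ht (hpos t ht) ξ)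
    (fun t ht => integrable_energyDensity hb cw (sol.sqIntegrableDerivs_left ht)
      (sol.sqIntegrableDerivs_right ht) ha.κ_pos ha.κ_le_half ha.one_le_Λ)
    (fun t ht => (integrable_sqSum (sol.sqIntegrableDerivs_left ht)
      (sol.sqIntegrableDerivs_right ht)).const_mul _)
    (fun t ht => ?_) (fun t ht ξ => ?_)
    (fun t ht ξ => sol.abs_flux_le hT hp hg htv htv_pos hb ha ht (hδ t ht) ξ) ?_
    (fun t ht => integral_bulkDensity_le hb ha hε hεc hΛ
      (continuous_bulkDensity hp hg htv htv_pos cw cw' (sol.sqIntegrableDerivs_left ht)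
        (sol.sqIntegrableDerivs_right ht) (hpos t ht)) (sol.sqIntegrableDerivs_left ht)
      (sol.sqIntegrableDerivs_right ht) (hδ t ht))
  · refine (hasDerivAt_energyTerm ?_ ?_ ?_ ?_ ?_).congr_deriv (balance t ht ξ)
    · exact (sol.tdiffΦ 0 (by norm_num) t ht ξ).hasDerivAt
    · exact (sol.tdiffΦ 3 le_rfl t ht ξ).hasDerivAt
    · exact (sol.tdiffΨ 0 (by norm_num) t ht ξ).hasDerivAt
    · exact (sol.tdiffΨ 2 (by norm_num) t ht ξ).hasDerivAt
    · exact (sol.tdiffΨ 3 le_rfl t ht ξ).hasDerivAt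
  · refine (continuousOn_energyRateTerm (κ := κ) (Λ := Λ)
      (cw.comp continuous_snd).continuousOn (sol.spContΦ 0 (by norm_num))
      (sol.spContΦ 3 (by norm_num)) (sol.spContΨ 0 (by norm_num)) (sol.spContΨ 2 (by norm_num))
      (sol.spContΨ 3 (by norm_num)) (sol.mixContΦ 0 (by norm_num)) (sol.mixContΦ 3 le_rfl)
      (sol.mixContΨ 0 (by norm_num)) (sol.mixContΨ 2 (by norm_num))
      (sol.mixContΨ 3 le_rfl)).congr fun q hq => ?_
    exact (balance q.1 hq.1 q.2).symm
  · rw [integral_const_mul]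
    exact mul_le_mul_of_nonneg_left (hM t ht) hL
  · have small := fun j hj => ((sol.sqIntegrableDerivs_left ht).abs_le_of_small
      (sol.sqIntegrableDerivs_right ht) (hδ t ht) (j := j) hj ξ).1
    exact abs_bulkDensity_le hb ha (small 1 (by norm_num)) (small 2 le_rfl)
  · exact ((sol.l2ContΦ 4 le_rfl).const_mul _).add ((sol.l2ContΨ 3 (by norm_num)).const_mul _)

end IsClassicalSolution

end

lemma exists_admissible {vp C c : ℝ} (hvp : 0 < vp) (hC : 1 ≤ C) (hc : 0 < c) :
    ∃ κ Λ δ ε : ℝ, 0 < δ ∧ 0 < ε ∧ Admissible vp C c κ Λ δ ∧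
      3 * (8 * C ^ 2 / c + 16 * C ^ 4 / κ + C) * (3 * ε) ≤ c / 4 ∧
      3 * (8 * C ^ 2 / c + 16 * C ^ 4 / κ + C) * (1 / ε ^ 2 + 2) ≤ Λ * (c / 2) := by
  have hC0 : 0 < C := by linarith
  obtain ⟨κ, hκ, k1, k2, k3⟩ : ∃ κ : ℝ, 0 < κ ∧ κ ≤ 1 / 2 ∧ κ ≤ c / 2 ∧ 16 * C ^ 2 * κ ≤ c := by
    refine ⟨min (1 / 2) (min (c / 2) (c / (16 * C ^ 2))), by positivity, min_le_left _ _,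
      (min_le_right _ _).trans (min_le_left _ _), ?_⟩
    rw [mul_comm, ← le_div_iff₀ (by positivity)]
    exact (min_le_right _ _).trans (min_le_right _ _)
  obtain ⟨K, hK⟩ : ∃ K, K = 3 * (8 * C ^ 2 / c + 16 * C ^ 4 / κ + C) := ⟨_, rfl⟩
  have K0 : 0 < K := by rw [hK]; positivity
  have e0 : 0 < c / (12 * K) := by positivity
  refine ⟨κ, 1 + 2 / c * (K * (1 / (c / (12 * K)) ^ 2 + 2)), min κ (min (vp / 2) (c / (2 * C))),
    c / (12 * K), by positivity, e0, ⟨hκ, k1, k2, k3, ?_, min_le_left _ _,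
      (min_le_right _ _).trans (min_le_left _ _), ?_⟩, ?_, ?_⟩
  · exact le_add_of_nonneg_right (by positivity)
  · rw [mul_comm, ← le_div_iff₀ (by positivity)]
    exact (min_le_right _ _).trans (min_le_right _ _)
  · rw [← hK]
    apply le_of_eq
    field_simp
    norm_num
  · rw [← hK]
    have e : (1 + 2 / c * (K * (1 / (c / (12 * K)) ^ 2 + 2))) * (c / 2)
        = c / 2 + K * (1 / (c / (12 * K)) ^ 2 + 2) := by
      rw [add_mul, one_mul, mul_right_comm, div_mul_div_comm, mul_comm 2 c,
        div_self (by positivity), one_mul]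
    rw [e]
    exact le_add_of_nonneg_left (by positivity)

lemma IsClassicalSolution.third_order_le {p g tv : ℝ → ℝ} {s T m κ c : ℝ} {Φ Ψ : ℝ → ℝ → ℝ}
    (sol : IsClassicalSolution p g tv s T Φ Ψ) (h1 : m ≤ 1 / 4) (h2 : m ≤ c / 4)
    (h3 : m ≤ κ / 2) {t : ℝ} (ht : t ∈ Icc 0 T) :
    m * (L2sq (iteratedDeriv 3 (Φ t)) + L2sq (iteratedDeriv 3 (Ψ t))
        + ∫ τ in (0:ℝ)..t, ∫ ξ : ℝ,
          ((iteratedDeriv 4 (Φ τ) ξ) ^ 2 + (iteratedDeriv 3 (Ψ τ) ξ) ^ 2))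
      ≤ 1 / 4 * L2sq (iteratedDeriv 3 (Φ t)) + c / 4 * L2sq (iteratedDeriv 3 (Ψ t))
        + ∫ τ in (0:ℝ)..t, (c / 4 * L2sq (iteratedDeriv 4 (Φ τ))
          + κ / 2 * L2sq (iteratedDeriv 3 (Ψ τ))) := by
  have hsub : uIcc 0 t ⊆ Icc 0 T := by
    rw [uIcc_of_le ht.1]
    exact Icc_subset_Icc_right ht.2
  have c4 := (sol.l2ContΦ 4 le_rfl).mono hsub
  have c3 := (sol.l2ContΨ 3 (by norm_num)).mono hsub
  have e : (∫ τ in (0:ℝ)..t, ∫ ξ : ℝ,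
      ((iteratedDeriv 4 (Φ τ) ξ) ^ 2 + (iteratedDeriv 3 (Ψ τ) ξ) ^ 2))
      = ∫ τ in (0:ℝ)..t, (L2sq (iteratedDeriv 4 (Φ τ)) + L2sq (iteratedDeriv 3 (Ψ τ))) :=
    intervalIntegral.integral_congr fun τ hτ =>
      integral_add (sol.sqIntΦ 4 le_rfl τ (hsub hτ)) (sol.sqIntΨ 3 (by norm_num) τ (hsub hτ))
  have i : ∫ τ in (0:ℝ)..t, m * (L2sq (iteratedDeriv 4 (Φ τ)) + L2sq (iteratedDeriv 3 (Ψ τ)))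
      ≤ ∫ τ in (0:ℝ)..t, (c / 4 * L2sq (iteratedDeriv 4 (Φ τ))
          + κ / 2 * L2sq (iteratedDeriv 3 (Ψ τ))) := by
    refine intervalIntegral.integral_mono ht.1
      ((c4.add c3).const_mul m).intervalIntegrable
      ((c4.const_mul _).add (c3.const_mul _)).intervalIntegrable fun τ => ?_
    have a1 := mul_le_mul_of_nonneg_right h2 (L2sq_nonneg (iteratedDeriv 4 (Φ τ)))
    have a2 := mul_le_mul_of_nonneg_right h3 (L2sq_nonneg (iteratedDeriv 3 (Ψ τ)))
    simp only
    linarith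
  rw [intervalIntegral.integral_const_mul] at i
  rw [e]
  have a1 := mul_le_mul_of_nonneg_right h1 (L2sq_nonneg (iteratedDeriv 3 (Φ t)))
  have a2 := mul_le_mul_of_nonneg_right h2 (L2sq_nonneg (iteratedDeriv 3 (Ψ t)))
  linarith

theorem third_order_energy_estimate
    (p : ℝ → ℝ)
    (hp_smooth : ContDiffOn ℝ (⊤ : ℕ∞) p (Set.Ioi 0))
    (hpd : ∀ v ∈ Set.Ioi (0:ℝ), deriv p v < 0)
    (hpdd : ∀ v ∈ Set.Ioi (0:ℝ), 0 ≤ deriv (deriv p) v)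
    (hpdd_ne : ∀ a b : ℝ, 0 < a → a < b → ∃ v ∈ Set.Ioo a b, deriv (deriv p) v ≠ 0)
    (μ : ℝ → ℝ)
    (hmu_smooth : ContDiffOn ℝ (⊤ : ℕ∞) μ (Set.Ioi 0))
    (hmu_pos : ∀ v ∈ Set.Ioi (0:ℝ), 0 < μ v)
    (vp vm s : ℝ)
    (hvp : 0 < vp) (hvpvm : vp < vm)
    (hs : s = -Real.sqrt (-((p vp - p vm) / (vp - vm))))
    (hsneg : s < 0)
    (g : ℝ → ℝ)
    (hg : ∀ z ∈ Set.Ioi (0:ℝ), HasDerivAt g (μ z / z) z)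
    (tv : ℝ → ℝ)
    (htv_smooth : ContDiff ℝ (⊤ : ℕ∞) tv)
    (htv_ode : ∀ ξ : ℝ, deriv tv ξ
        = tv ξ / (-s * μ (tv ξ)) * (s ^ 2 * (tv ξ - vm) + p (tv ξ) - p vm))
    (htv_mem : ∀ ξ : ℝ, tv ξ ∈ Set.Ioo vp vm)
    (htv_dec : ∀ ξ : ℝ, deriv tv ξ < 0)
    (htv_bot : Filter.Tendsto tv Filter.atBot (nhds vm))
    (htv_top : Filter.Tendsto tv Filter.atTop (nhds vp))
    (htv_bdd : ∀ k : ℕ, ∃ M : ℝ, ∀ ξ : ℝ, |iteratedDeriv k tv ξ| ≤ M)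
 :
    ∃ δ₀ > (0:ℝ), ∃ C > (0:ℝ), ∀ T > (0:ℝ), ∀ δ ≤ δ₀, ∀ Φ Ψ : ℝ → ℝ → ℝ,
      IsClassicalSolution p g tv s T Φ Ψ →
      (∀ t ∈ Set.Icc (0:ℝ) T, Real.sqrt (pairHkSq 3 (Φ t) (Ψ t)) ≤ δ) →
      ∀ t ∈ Set.Icc (0:ℝ) T,
        L2sq (iteratedDeriv 3 (Φ t)) + L2sq (iteratedDeriv 3 (Ψ t))
            + (∫ τ in (0:ℝ)..t, ∫ ξ : ℝ,
                ((iteratedDeriv 4 (Φ τ) ξ) ^ 2 + (iteratedDeriv 3 (Ψ τ) ξ) ^ 2))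
          ≤ C * pairHkSq 3 (Φ 0) (Ψ 0) := by
  have hg_smooth : ContDiffOn ℝ (⊤ : ℕ∞) g (Ioi 0) :=
    (contDiffOn_infty_iff_deriv_of_isOpen isOpen_Ioi).2
      ⟨fun z hz => (hg z hz).differentiableAt.differentiableWithinAt,
        (hmu_smooth.div contDiffOn_id fun z hz => ne_of_gt hz).congr fun z hz => (hg z hz).deriv⟩
  have hgd : ∀ v > 0, 0 < iteratedDeriv 1 g v := fun v hv => by
    rw [iteratedDeriv_one, (hg v hv).deriv]
    exact div_pos (hmu_pos v hv) hv
  have hpd' : ∀ v > 0, iteratedDeriv 1 p v < 0 := by simpa using hpd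
  have hpdd' : ∀ v > 0, 0 ≤ iteratedDeriv 2 p v := fun v hv => by
    rw [iteratedDeriv_succ, iteratedDeriv_one]
    exact hpdd v hv
  have htv_pos : ∀ ξ, 0 < tv ξ := fun ξ => hvp.trans (htv_mem ξ).1
  obtain ⟨C, c, hb⟩ := exists_coefficient_bounds hp_smooth hg_smooth hpd' hpdd' hgd hsneg hvp
    htv_mem (by simpa using htv_dec) htv_bdd
  obtain ⟨κ, Λ, δ₀, ε, hδ₀, hε, ha, hεc, hΛ⟩ := exists_admissible hvp hb.one_le hb.pos
  have hc := hb.pos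
  have hκ := ha.κ_pos
  have hC : 0 < C := by linarith [hb.one_le]
  have hΛ0 : 0 < Λ := by linarith [ha.one_le_Λ]
  have cw := (continuous_profileWeight hp_smooth htv_smooth htv_pos hpd').1
  obtain ⟨m, hm, m1, m2, m3⟩ : ∃ m : ℝ, 0 < m ∧ m ≤ 1 / 4 ∧ m ≤ c / 4 ∧ m ≤ κ / 2 :=
    ⟨min (1 / 4) (min (c / 4) (κ / 2)), by positivity, min_le_left _ _,
      (min_le_right _ _).trans (min_le_left _ _), (min_le_right _ _).trans (min_le_right _ _)⟩
  refine ⟨δ₀, hδ₀, Λ * C / m, by positivity, fun T hT δ hδ Φ Ψ sol small t ht => ?_⟩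
  have h0 : (0:ℝ) ∈ Icc 0 T := ⟨le_rfl, hT.le⟩
  have main := sol.energyDensity_estimate hT hp_smooth hg_smooth htv_smooth htv_pos hpd' hb ha hε
    hεc hΛ (fun τ hτ => (small τ hτ).trans hδ) t ht
  have upper := integral_energyDensity_le hb cw (sol.sqIntegrableDerivs_left h0)
    (sol.sqIntegrableDerivs_right h0) hκ ha.κ_le_half ha.one_le_Λ
  have lower := le_integral_energyDensity hb cw (sol.sqIntegrableDerivs_left ht)
    (sol.sqIntegrableDerivs_right ht) hκ ha.κ_le_half ha.κ_le ha.one_le_Λ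
  have third := sol.third_order_le m1 m2 m3 ht
  rw [div_mul_eq_mul_div, le_div_iff₀ hm]
  linarith
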